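/- arXiv:2012.11999 — 3 statements merged into one kernel-verified Lean document; each statement's English description precedes it below -/
import Mathlib

section
/- Let d ≥ 2, let η be the d × d diagonal matrix diag(-1, 1, …, 1), and let F and F̃ be real d × d matrices satisfying Fᵀ·η = -η·F and F̃ᵀ·η = -η·F̃ (i.e. they are skew-symmetric with respect to the Minkowski form). Then F and F̃ have the same characteristic polynomial and the same rank if and only if there exists a real d × d matrix Λ with Λᵀ·η·Λ = η and Λ 0 0 > 0 (an orthochronous Lorentz transformation) such that F̃ = Λ·F·Λ⁻¹. -/
open Matrix

/-- The matrix `diag(-1, 1, …, 1)` of the Minkowski form on `ℝ^d`. -/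
noncomputable def etaMat (d : ℕ) : Matrix (Fin d) (Fin d) ℝ :=
  Matrix.diagonal fun i => if (i : ℕ) = 0 then (-1 : ℝ) else 1

theorem charpoly_I_smul_map_eq {n : Type*} [Fintype n] [DecidableEq n] {A A' : Matrix n n ℝ}
    (h : A.charpoly = A'.charpoly) :
    (Complex.I • A.map Complex.ofReal).charpoly = (Complex.I • A'.map Complex.ofReal).charpoly := by
  have key (M : Matrix n n ℝ) (z : ℂ) : (Complex.I • M.map Complex.ofReal).charpoly.eval z =
      Complex.I ^ Fintype.card n * (M.charpoly.map Complex.ofRealHom).eval (-Complex.I * z) := by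
    rw [← Matrix.charpoly_map, Matrix.eval_charpoly, Matrix.eval_charpoly, ← Matrix.det_smul]
    congr 1
    ext i j
    simp [Matrix.scalar_apply, Matrix.diagonal_apply, mul_sub]
    split_ifs <;> simp [← mul_assoc]
  refine Polynomial.funext fun z => ?_
  rw [key, key, h]

theorem isHermitian_I_smul_map {n : Type*} {A : Matrix n n ℝ} (hA : Aᵀ = -A) :
    (Complex.I • A.map Complex.ofReal).IsHermitian := by
  ext i j
  have := congrFun (congrFun hA i) j
  simp only [Matrix.transpose_apply, Matrix.neg_apply] at this
  simp [this]

/-- Real skew-symmetric matrices with the same characteristic polynomial are similar over `ℂ`. -/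
theorem exists_complex_intertwiner {n : Type*} [Fintype n] [DecidableEq n] {A A' : Matrix n n ℝ}
    (hA : Aᵀ = -A) (hA' : A'ᵀ = -A') (h : A.charpoly = A'.charpoly) :
    ∃ T : Matrix n n ℂ, T.det ≠ 0 ∧
      T * A.map Complex.ofReal = A'.map Complex.ofReal * T := by
  have H := isHermitian_I_smul_map hA
  have H' := isHermitian_I_smul_map hA'
  have he := (H.eigenvalues_eq_eigenvalues_iff H').2 (charpoly_I_smul_map_eq h)
  have s := H.spectral_theorem
  have s' := H'.spectral_theorem
  rw [← he] at s'
  rw [Unitary.conjStarAlgAut_apply] at s s'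
  set U : Matrix n n ℂ := ↑H.eigenvectorUnitary
  set U' : Matrix n n ℂ := ↑H'.eigenvectorUnitary
  set D : Matrix n n ℂ := diagonal (RCLike.ofReal ∘ H.eigenvalues)
  have hU : star U * U = 1 := Unitary.coe_star_mul_self _
  have hU1 : U * star U = 1 := Unitary.coe_mul_star_self _
  have hU' : star U' * U' = 1 := Unitary.coe_star_mul_self _
  refine ⟨U' * star U, ?_, ?_⟩
  · have : (U' * star U) * (U * star U') = 1 := by
      rw [mul_assoc, ← mul_assoc (star U), hU, one_mul]; exact Unitary.coe_mul_star_self _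
    exact (Matrix.isUnit_det_of_right_inverse this).ne_zero
  · have e : (U' * star U) * (Complex.I • A.map Complex.ofReal) =
        (Complex.I • A'.map Complex.ofReal) * (U' * star U) := by
      calc _ = U' * (star U * U) * D * star U := by rw [s]; simp only [mul_assoc]
        _ = U' * D * (star U' * U') * star U := by rw [hU, hU']; simp [mul_assoc]
        _ = _ := by rw [s']; simp only [mul_assoc]
    rw [Matrix.mul_smul, Matrix.smul_mul] at e
    exact smul_right_injective _ Complex.I_ne_zero e

/-- Real matrices that are similar over `ℂ` are similar over `ℝ`. -/
theorem exists_real_intertwiner {n : Type*} [Fintype n] [DecidableEq n] {A A' : Matrix n n ℝ}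
    {T : Matrix n n ℂ} (hT : T.det ≠ 0)
    (h : T * A.map Complex.ofReal = A'.map Complex.ofReal * T) :
    ∃ S : Matrix n n ℝ, S.det ≠ 0 ∧ S * A = A' * S := by
  set X := T.map Complex.re
  set Y := T.map Complex.im
  have hX : X * A = A' * X := by
    ext i j
    have := congrArg Complex.re (congrFun (congrFun h i) j)
    simpa [Matrix.mul_apply, X] using this
  have hY : Y * A = A' * Y := by
    ext i j
    have := congrArg Complex.im (congrFun (congrFun h i) j)
    simpa [Matrix.mul_apply, Y] using this
  set p : Polynomial ℝ :=
    (X.map Polynomial.C + (Polynomial.X : Polynomial ℝ) • Y.map Polynomial.C).det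
  have hp : p ≠ 0 := by
    intro h0
    apply hT
    have : p.eval₂ Complex.ofRealHom Complex.I = T.det := by
      rw [← Polynomial.coe_eval₂RingHom, RingHom.map_det]
      congr 1
      ext i j
      simp [X, Y, Complex.re_add_im]
    rw [← this, h0, Polynomial.eval₂_zero]
  obtain ⟨c, hc⟩ : ∃ c, p.eval c ≠ 0 := by
    by_contra! hc
    exact hp (Polynomial.funext (by simpa using hc))
  refine ⟨X + c • Y, ?_, ?_⟩
  · have : p.eval c = (X + c • Y).det := by
      rw [← Polynomial.coe_evalRingHom, RingHom.map_det]
      congr 1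
      ext i j
      simp [mul_comm c]
    rwa [← this]
  · rw [add_mul, mul_add, Matrix.smul_mul, Matrix.mul_smul, hX, hY]

open scoped MatrixOrder ComplexOrder in
/-- The orthogonal factor of an intertwiner of skew-symmetric matrices is an intertwiner. -/
theorem exists_orthogonal_intertwiner {n : Type*} [Fintype n] [DecidableEq n]
    {A A' S : Matrix n n ℝ} (hA : Aᵀ = -A) (hA' : A'ᵀ = -A') (hS : S.det ≠ 0)
    (h : S * A = A' * S) :
    ∃ O : Matrix n n ℝ, Oᵀ * O = 1 ∧ O * A = A' * O := by
  have hH : (Sᵀ * S).PosSemidef := by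
    simpa using Matrix.posSemidef_conjTranspose_mul_self S
  have hsym : A * Sᵀ = Sᵀ * A' := by
    have := congrArg Matrix.transpose h
    rw [Matrix.transpose_mul, Matrix.transpose_mul, hA, hA'] at this
    simpa using this
  have hcomm : Commute (Sᵀ * S) A := by
    change Sᵀ * S * A = A * (Sᵀ * S)
    rw [mul_assoc, h, ← mul_assoc, ← hsym, mul_assoc]
  set P := CFC.sqrt (Sᵀ * S)
  have hP2 : P * P = Sᵀ * S := CFC.sqrt_mul_sqrt_self _ hH.nonneg
  have hPT : Pᵀ = P := by
    have := (CFC.sqrt_nonneg (Sᵀ * S)).posSemidef.isHermitian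
    simpa [Matrix.IsHermitian] using this
  have hPA : P * A = A * P := by
    have : Commute (CFC.sqrt (Sᵀ * S)) A := by
      rw [CFC.sqrt_eq_cfc]
      exact hcomm.cfc_nnreal _
    exact this
  have hPd : IsUnit P.det := by
    have := congrArg Matrix.det hP2
    simp only [Matrix.det_mul, Matrix.det_transpose] at this
    refine isUnit_iff_ne_zero.2 fun h0 => ?_
    rw [h0, zero_mul] at this
    exact hS (by simpa using this.symm)
  refine ⟨S * P⁻¹, ?_, ?_⟩
  · rw [Matrix.transpose_mul, Matrix.transpose_nonsing_inv, hPT]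
    calc P⁻¹ * Sᵀ * (S * P⁻¹) = P⁻¹ * (P * P) * P⁻¹ := by rw [hP2]; simp only [mul_assoc]
      _ = 1 := by rw [← mul_assoc, Matrix.nonsing_inv_mul _ hPd, one_mul,
        Matrix.mul_nonsing_inv _ hPd]
  · have : P⁻¹ * A = A * P⁻¹ := by
      calc P⁻¹ * A = P⁻¹ * (A * P) * P⁻¹ := by
            rw [mul_assoc, mul_assoc, Matrix.mul_nonsing_inv _ hPd, mul_one]
        _ = A * P⁻¹ := by rw [← hPA, ← mul_assoc, Matrix.nonsing_inv_mul _ hPd, one_mul]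
    rw [mul_assoc, this, ← mul_assoc, h, mul_assoc]

/-- Real skew-symmetric matrices with the same characteristic polynomial are orthogonally
similar. -/
theorem exists_orthogonal_of_charpoly_eq {n : Type*} [Fintype n] [DecidableEq n]
    {A A' : Matrix n n ℝ} (hA : Aᵀ = -A) (hA' : A'ᵀ = -A') (h : A.charpoly = A'.charpoly) :
    ∃ O : Matrix n n ℝ, Oᵀ * O = 1 ∧ O * A = A' * O := by
  obtain ⟨T, hT, hTA⟩ := exists_complex_intertwiner hA hA' h
  obtain ⟨S, hS, hSA⟩ := exists_real_intertwiner hT hTA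
  exact exists_orthogonal_intertwiner hA hA' hS hSA

theorem rank_eq_of_charpoly_eq {n n' : Type*} [Fintype n] [DecidableEq n] [Fintype n']
    [DecidableEq n'] {A : Matrix n n ℝ} {A' : Matrix n' n' ℝ} (hA : Aᵀ = -A) (hA' : A'ᵀ = -A')
    (h : A.charpoly = A'.charpoly) : A.rank = A'.rank := by
  have hcard : Fintype.card n' = Fintype.card n := by
    simpa using congrArg Polynomial.natDegree h.symm
  let e := Fintype.equivOfCardEq hcard
  obtain ⟨O, hO, hOA⟩ := exists_orthogonal_of_charpoly_eq (A' := Matrix.reindex e e A') hA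
    (by ext i j; exact congrFun (congrFun hA' _) _) (by rw [h, Matrix.charpoly_reindex])
  have hOu : IsUnit O.det := Matrix.isUnit_det_of_left_inverse hO
  rw [← Matrix.rank_reindex e e A', ← Matrix.rank_mul_eq_right_of_isUnit_det O A hOu, hOA,
    Matrix.rank_mul_eq_left_of_isUnit_det _ _ hOu]

theorem rank_fromBlocks_diag {m n : Type*} [Fintype n] [DecidableEq n] [Fintype m]
    [DecidableEq m] (A : Matrix m m ℝ) (D : Matrix n n ℝ) :
    (Matrix.fromBlocks A 0 0 D).rank = A.rank + D.rank := by
  have := LinearMap.toMatrix_prodMap (Pi.basisFun ℝ m) (Pi.basisFun ℝ n) (Matrix.toLin' A)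
    (Matrix.toLin' D)
  simp only [← Matrix.toLin_eq_toLin', LinearMap.toMatrix_toLin] at this
  rw [← this, Matrix.rank_eq_finrank_range_toLin _ ((Pi.basisFun ℝ m).prod (Pi.basisFun ℝ n))
    ((Pi.basisFun ℝ m).prod (Pi.basisFun ℝ n)), Matrix.toLin_toMatrix, LinearMap.range_prodMap,
    Matrix.rank_eq_finrank_range_toLin A (Pi.basisFun ℝ m) (Pi.basisFun ℝ m),
    Matrix.rank_eq_finrank_range_toLin D (Pi.basisFun ℝ n) (Pi.basisFun ℝ n)]
  have hr (p : Submodule ℝ (m → ℝ)) (q : Submodule ℝ (n → ℝ)) :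
      Module.finrank ℝ (p.prod q) = Module.finrank ℝ p + Module.finrank ℝ q := by
    rw [← Module.finrank_prod, ← LinearMap.finrank_range_of_inj
      (f := p.subtype.prodMap q.subtype) (p.subtype_injective.prodMap q.subtype_injective),
      LinearMap.range_prodMap, Submodule.range_subtype, Submodule.range_subtype]
  exact hr _ _

/-- A symmetric bilinear form of index one: it takes a negative value, and is positive definite on
the orthogonal complement of every vector on which it is negative. -/
structure IsLorentzian {V : Type*} [AddCommGroup V] [Module ℝ V]
    (B : LinearMap.BilinForm ℝ V) : Prop where
  symm : ∀ x y, B x y = B y x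
  exists_neg : ∃ v, B v v < 0
  pos_of_ortho : ∀ x y, B x x < 0 → B x y = 0 → y ≠ 0 → 0 < B y y

namespace IsLorentzian

variable {V : Type*} [AddCommGroup V] [Module ℝ V] {B : LinearMap.BilinForm ℝ V}

theorem exists_smul_or_pos (hB : IsLorentzian B) {x y : V} (hx : x ≠ 0) (hxx : B x x = 0)
    (hxy : B x y = 0) : (∃ c : ℝ, y = c • x) ∨ 0 < B y y := by
  obtain ⟨v, hv⟩ := hB.exists_neg
  have hvx : B v x ≠ 0 := fun h => (hB.pos_of_ortho v x hv h hx).ne' hxx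
  by_cases h : y = (B v y / B v x) • x
  · exact Or.inl ⟨_, h⟩
  · right
    have := hB.pos_of_ortho v (y - (B v y / B v x) • x) hv (by simp [hvx]) (sub_ne_zero.2 h)
    simpa [hxx, hxy, hB.symm y x] using this

theorem exists_eq_of_forall_ker [FiniteDimensional ℝ V] (hB : IsLorentzian B) (g : V →ₗ[ℝ] V)
    (hg : ∀ x y, B (g x) y = B x (g y)) {n : V} (hn : ∀ w, g w = 0 → B n w = 0) :
    ∃ m, g m = n := by
  have hinj : Function.Injective B := by
    rw [injective_iff_map_eq_zero]
    intro x hx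
    by_contra hx0
    obtain ⟨v, hv⟩ := hB.exists_neg
    have := hB.pos_of_ortho v x hv (by rw [hB.symm, hx]; rfl) hx0
    simp [hx] at this
  have hsurj : Function.Surjective B :=
    (LinearMap.injective_iff_surjective_of_finrank_eq_finrank
      (Subspace.dual_finrank_eq (K := ℝ) (V := V)).symm).1 hinj
  have hmem : B n ∈ LinearMap.range g.dualMap := by
    rw [LinearMap.range_dualMap_eq_dualAnnihilator_ker, Submodule.mem_dualAnnihilator]
    exact fun w hw => hn w hw
  obtain ⟨φ, hφ⟩ := hmem
  obtain ⟨m, rfl⟩ := hsurj φ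
  refine ⟨m, hinj (LinearMap.ext fun w => ?_)⟩
  rw [← hφ, hg]
  rfl

/-- A skew endomorphism with eigenvalues `l` and `-l` acts as a boost on a hyperbolic plane. -/
theorem exists_boost_frame (hB : IsLorentzian B) {f : V →ₗ[ℝ] V}
    (hf : ∀ x y, B (f x) y = -B x (f y)) {l : ℝ} (hl : l ≠ 0) {n m : V} (hn0 : n ≠ 0)
    (hm0 : m ≠ 0) (hn : f n = l • n) (hm : f m = -l • m) :
    ∃ w : Fin 2 → V, f (w 0) = l • w 0 ∧ f (w 1) = -l • w 1 ∧ B (w 0) (w 0) = 0 ∧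
      B (w 1) (w 1) = 0 ∧ B (w 0) (w 1) = -1 := by
  have hnn : B n n = 0 := by
    have := hf n n
    simp only [hn, map_smul, LinearMap.smul_apply, smul_eq_mul] at this
    have : l * B n n = 0 := by linarith
    exact (mul_eq_zero.1 this).resolve_left hl
  have hmm : B m m = 0 := by
    have := hf m m
    simp only [hm, map_smul, LinearMap.smul_apply, smul_eq_mul] at this
    have : l * B m m = 0 := by linarith
    exact (mul_eq_zero.1 this).resolve_left hl
  have hnm : B n m ≠ 0 := by
    intro h
    rcases hB.exists_smul_or_pos hn0 hnn h with ⟨c, hc⟩ | h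
    · have h1 : (2 * l) • m = 0 := by
        have h2 : f m = l • m := by rw [hc, map_smul, hn, smul_comm]
        rw [hm] at h2
        have : (2 * l) • m = l • m - (-l) • m := by module
        rw [this, h2, sub_self]
      rcases smul_eq_zero.1 h1 with h | h
      · exact hl (by linarith)
      · exact hm0 h
    · exact h.ne' hmm
  refine ⟨![n, (-(B n m)⁻¹) • m], hn, ?_, hnn, ?_, ?_⟩
  · simp only [Matrix.cons_val_one, Matrix.cons_val_zero, map_smul, hm]
    rw [smul_comm]
  · simp [hmm]
  · simp [hnm]

/-- A skew endomorphism whose kernel is degenerate and contains no timelike vector acts as a null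
rotation on a three-dimensional subspace. -/
theorem exists_nullRotation_frame [FiniteDimensional ℝ V] (hB : IsLorentzian B) {f : V →ₗ[ℝ] V}
    (hf : ∀ x y, B (f x) y = -B x (f y)) (hker : ∀ k, f k = 0 → 0 ≤ B k k) {n : V} (hn0 : n ≠ 0)
    (hn : f n = 0) (hnn : B n n = 0) :
    ∃ w : Fin 3 → V, f (w 0) = 0 ∧ f (w 1) = w 0 ∧ f (w 2) = w 1 ∧ B (w 0) (w 0) = 0 ∧
      B (w 0) (w 1) = 0 ∧ B (w 0) (w 2) = -1 ∧ B (w 1) (w 1) = 1 ∧ B (w 1) (w 2) = 0 ∧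
      B (w 2) (w 2) = 0 := by
  obtain ⟨m, hm⟩ := hB.exists_eq_of_forall_ker (f ∘ₗ f) (n := n)
    (fun x y => by simp only [LinearMap.comp_apply, hf, neg_neg]) (by
      intro w hw
      have hw : f (f w) = 0 := hw
      have h1 : B (f w) (f w) = 0 := by rw [hf, hw]; simp
      have h2 : B n (f w) = 0 := by
        have := hf n w
        rw [hn] at this
        simpa using this.symm
      rcases hB.exists_smul_or_pos hn0 hnn h2 with ⟨c, hc⟩ | h
      · by_cases hc0 : c = 0
        · rw [hc0, zero_smul] at hc
          by_contra hnw
          have h3 : ∀ s : ℝ, 0 ≤ 2 * s * B n w + B w w := by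
            intro s
            have := hker (s • n + w) (by simp [hn, hc])
            simp only [map_add, map_smul, LinearMap.add_apply, LinearMap.smul_apply, smul_eq_mul,
              hnn, hB.symm w n] at this
            linarith
          have := h3 (-(B w w + 1) / (2 * B n w))
          have h4 : 2 * (-(B w w + 1) / (2 * B n w)) * B n w = -(B w w + 1) := by
            field_simp
          linarith
        · have h5 : B (f w) w = 0 := by
            have := hf w w
            rw [hB.symm w (f w)] at this
            linarith
          rw [hc] at h5
          simpa [hc0] using h5
      · exact absurd h1 h.ne')
  have hm : f (f m) = n := hm
  have hnu : B n (f m) = 0 := by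
    have := hf n m
    rw [hn] at this
    simpa using this.symm
  have huu : 0 < B (f m) (f m) := by
    rcases hB.exists_smul_or_pos hn0 hnn hnu with ⟨c, hc⟩ | h
    · rw [hc, map_smul, hn, smul_zero] at hm
      exact absurd hm.symm hn0
    · exact h
  have hum : B (f m) m = 0 := by
    have := hf m m
    rw [hB.symm m (f m)] at this
    linarith
  have hnm : B n m = -B (f m) (f m) := by
    rw [hB.symm, ← hm, hf m (f m)]
    ring
  set q := B (f m) (f m) with hq
  set c := (√q)⁻¹ with hc
  have hc2 : c * c * q = 1 := by
    have := Real.mul_self_sqrt huu.le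
    rw [hc, ← mul_inv, this, inv_mul_cancel₀ huu.ne']
  refine ⟨![c • n, c • f m, c • (m + (B m m / (2 * q)) • n)], ?_, ?_, ?_, ?_, ?_, ?_, ?_, ?_, ?_⟩
  · simp [hn]
  · simp [hm]
  · simp [hn]
  · simp [hnn]
  · simp [hnu]
  · simp [hnm, hnn]
    linarith
  · simp [← hq]
    linarith
  · simp [hum, hB.symm (f m) n, hnu]
  · simp [hnn, hB.symm m n, hnm]
    field_simp
    ring

end IsLorentzian

theorem exists_orthonormal_basis {W : Type*} [AddCommGroup W] [Module ℝ W] [FiniteDimensional ℝ W]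
    (B : LinearMap.BilinForm ℝ W) (hs : ∀ x y, B x y = B y x) (hpos : ∀ x, x ≠ 0 → 0 < B x x) :
    ∃ b : Module.Basis (Fin (Module.finrank ℝ W)) ℝ W,
      ∀ i j, B (b i) (b j) = if i = j then 1 else 0 := by
  obtain ⟨v, hv⟩ := LinearMap.BilinForm.exists_orthogonal_basis (B := B) ⟨hs⟩
  have hp i : 0 < B (v i) (v i) := hpos _ (v.ne_zero i)
  refine ⟨v.isUnitSMul (w := fun i => (√(B (v i) (v i)))⁻¹)
    (fun i => isUnit_iff_ne_zero.2 (inv_ne_zero (Real.sqrt_pos.2 (hp i)).ne')), fun i j => ?_⟩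
  simp only [Module.Basis.isUnitSMul_apply, map_smul, LinearMap.smul_apply, smul_eq_mul]
  split_ifs with h
  · subst h
    rw [← mul_assoc, ← mul_inv, Real.mul_self_sqrt (hp i).le, inv_mul_cancel₀ (hp i).ne']
  · have : B (v i) (v j) = 0 := hv h
    simp [this]

/-- An invariant nondegenerate subspace containing a timelike vector has an orthonormal, invariant
complement. -/
theorem IsLorentzian.exists_complement {V : Type*} [AddCommGroup V] [Module ℝ V]
    [FiniteDimensional ℝ V] {B : LinearMap.BilinForm ℝ V} (hB : IsLorentzian B) {f : V →ₗ[ℝ] V}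
    (hf : ∀ x y, B (f x) y = -B x (f y)) {ι : Type*} [Fintype ι] [DecidableEq ι] (w : ι → V)
    (N : Matrix ι ι ℝ) (hN : ∀ j, f (w j) = ∑ i, N i j • w i)
    (hG : (Matrix.of fun i j => B (w i) (w j)).det ≠ 0) {v : V}
    (hv : v ∈ Submodule.span ℝ (Set.range w)) (hvv : B v v < 0) :
    ∃ (m : ℕ) (b : Fin m → V) (A : Matrix (Fin m) (Fin m) ℝ),
      Fintype.card ι + m = Module.finrank ℝ V ∧ (∀ i j, B (w i) (b j) = 0) ∧
      (∀ i j, B (b i) (b j) = if i = j then 1 else 0) ∧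
      (∀ j, f (b j) = ∑ i, A i j • b i) ∧ Aᵀ = -A := by
  have hsum (c : ι → ℝ) (hc : ∀ j, B (w j) (∑ i, c i • w i) = 0) : c = 0 := by
    by_contra hc0
    refine hG (Matrix.exists_mulVec_eq_zero_iff.1 ⟨c, hc0, ?_⟩)
    ext j
    simpa [Matrix.mulVec, dotProduct, mul_comm] using hc j
  have hli : LinearIndependent ℝ w := by
    rw [Fintype.linearIndependent_iff]
    intro c hc i
    rw [hsum c (fun j => by rw [hc, map_zero])]
    rfl
  set W := Submodule.span ℝ (Set.range w) with hW
  have hrefl : B.IsRefl := fun x y h => by rw [hB.symm, h]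
  have hmem (x : V) : x ∈ B.orthogonal W ↔ ∀ i, B (w i) x = 0 := by
    rw [LinearMap.BilinForm.mem_orthogonal_iff]
    refine ⟨fun h i => h _ (Submodule.subset_span ⟨i, rfl⟩), fun h y hy => ?_⟩
    have hle : W ≤ LinearMap.ker (B.flip x) := by
      rw [hW, Submodule.span_le]
      rintro _ ⟨i, rfl⟩
      exact h i
    exact hle hy
  have hdisj : Disjoint W (B.orthogonal W) := by
    rw [Submodule.disjoint_def]
    intro x hx hx'
    obtain ⟨c, rfl⟩ := (Submodule.mem_span_range_iff_exists_fun ℝ).1 hx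
    rw [hsum c ((hmem _).1 hx')]
    simp
  have hcompl := (LinearMap.BilinForm.isCompl_orthogonal_iff_disjoint hrefl).2 hdisj
  obtain ⟨b, hb⟩ := exists_orthonormal_basis (B.restrict (B.orthogonal W))
    (fun x y => hB.symm _ _) (fun x hx => hB.pos_of_ortho v x hvv (x.2 v hv) (by simpa using hx))
  have hinv (x : V) (hx : x ∈ B.orthogonal W) : f x ∈ B.orthogonal W := by
    rw [hmem] at hx ⊢
    intro i
    rw [← neg_eq_zero, ← hf, hN]
    simp [hx]
  refine ⟨_, fun i => b i, Matrix.of fun i j => B (b i) (f (b j)), ?_, ?_, hb, ?_, ?_⟩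
  · rw [← Submodule.finrank_add_eq_of_isCompl hcompl, hW, finrank_span_eq_card hli]
  · exact fun i j => (hmem _).1 (b j).2 i
  · intro j
    obtain ⟨y, hy⟩ : ∃ y : B.orthogonal W, f (b j) = y := ⟨⟨_, hinv _ (b j).2⟩, rfl⟩
    have hr := congrArg Subtype.val (b.sum_repr y)
    simp only [Submodule.coe_sum, Submodule.coe_smul] at hr
    have hb' : ∀ i j, B (b i : V) (b j) = if i = j then 1 else 0 := hb
    simp only [Matrix.of_apply, hy, ← hr]
    simp [hb']
  · ext i j
    simp only [Matrix.transpose_apply, Matrix.of_apply, Matrix.neg_apply]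
    rw [← hf, hB.symm]

/-- The Minkowski bilinear form on `ℝ^d`. -/
noncomputable def minkowskiForm (d : ℕ) : LinearMap.BilinForm ℝ (Fin d → ℝ) :=
  Matrix.toBilin' (etaMat d)

theorem minkowskiForm_apply' (d : ℕ) (x y : Fin d → ℝ) :
    minkowskiForm d x y = x ⬝ᵥ etaMat d *ᵥ y := Matrix.toBilin'_apply' _ _ _

theorem minkowskiForm_apply (n : ℕ) (x y : Fin (n + 1) → ℝ) :
    minkowskiForm (n + 1) x y = -(x 0 * y 0) + ∑ i : Fin n, x i.succ * y i.succ := by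
  simp [minkowskiForm_apply', etaMat, Matrix.mulVec_diagonal, dotProduct, Fin.sum_univ_succ]

theorem etaMat_transpose (d : ℕ) : (etaMat d)ᵀ = etaMat d := Matrix.diagonal_transpose _

theorem etaMat_mul_self (d : ℕ) : etaMat d * etaMat d = 1 := by
  rw [etaMat, Matrix.diagonal_mul_diagonal, ← Matrix.diagonal_one]
  congr 1
  ext i
  split_ifs <;> norm_num

theorem etaMat_det (n : ℕ) : (etaMat (n + 1)).det = -1 := by
  simp [etaMat, Matrix.det_diagonal]

theorem isLorentzian_minkowskiForm (n : ℕ) : IsLorentzian (minkowskiForm (n + 1)) where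
  symm x y := by simp only [minkowskiForm_apply, mul_comm]
  exists_neg := ⟨Pi.single 0 1, by simp [minkowskiForm_apply]⟩
  pos_of_ortho x y hx hxy hy := by
    simp only [minkowskiForm_apply] at *
    have hcs := Finset.sum_mul_sq_le_sq_mul_sq Finset.univ (fun i : Fin n => x i.succ)
      (fun i => y i.succ)
    have hxs : ∑ i : Fin n, x i.succ ^ 2 < x 0 ^ 2 := by
      simp only [sq]
      linarith
    simp only [← sq]
    by_contra! hle
    have hys : ∑ i : Fin n, y i.succ ^ 2 ≤ y 0 ^ 2 := by linarith
    have hy0 : y 0 = 0 := by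
      by_contra h0
      have h1 : 0 < y 0 ^ 2 := by positivity
      have h2 : ∑ i : Fin n, x i.succ * y i.succ = x 0 * y 0 := by linarith
      have h3 : 0 ≤ ∑ i : Fin n, x i.succ ^ 2 := Finset.sum_nonneg fun _ _ => sq_nonneg _
      rw [h2] at hcs
      have h4 := mul_le_mul_of_nonneg_left hys h3
      have h5 := mul_lt_mul_of_pos_right hxs h1
      nlinarith
    rw [hy0] at hys
    have hz := (Finset.sum_eq_zero_iff_of_nonneg (s := Finset.univ)
      (f := fun i : Fin n => y i.succ ^ 2) fun _ _ => sq_nonneg _).1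
        (le_antisymm (by simpa using hys) (Finset.sum_nonneg fun _ _ => sq_nonneg _))
    refine hy (funext fun i => ?_)
    refine Fin.cases hy0 (fun j => ?_) i
    simpa using hz j (Finset.mem_univ j)

theorem minkowskiForm_toLin'_left {d : ℕ} {F : Matrix (Fin d) (Fin d) ℝ}
    (hF : Fᵀ * etaMat d = -(etaMat d * F)) (x y : Fin d → ℝ) :
    minkowskiForm d (Matrix.toLin' F x) y = -minkowskiForm d x (Matrix.toLin' F y) := by
  simp only [minkowskiForm_apply', Matrix.toLin'_apply]
  rw [← Matrix.vecMul_transpose F x, ← Matrix.dotProduct_mulVec, Matrix.mulVec_mulVec, hF,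
    Matrix.neg_mulVec, dotProduct_neg, Matrix.mulVec_mulVec]

theorem Polynomial.Monic.eval_pos_of_forall_ne_zero {p : Polynomial ℝ} (hp : p.Monic)
    (h : ∀ t, 0 < t → p.eval t ≠ 0) {t : ℝ} (ht : 0 < t) : 0 < p.eval t := by
  by_contra! hle
  have hdeg : 0 < p.degree := by
    by_contra! hd
    rw [Polynomial.eq_C_of_degree_le_zero hd] at hp hle
    have : p.coeff 0 = 1 := by simpa [Polynomial.Monic] using hp
    simp [this] at hle
    linarith
  obtain ⟨s, hs, hts⟩ := ((p.tendsto_atTop_of_leadingCoeff_nonneg hdeg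
    (by rw [hp.leadingCoeff]; exact zero_le_one)).eventually_ge_atTop 0 |>.and
      (Filter.eventually_ge_atTop t)).exists
  obtain ⟨r, hr, hr0⟩ := intermediate_value_Icc hts p.continuous.continuousOn ⟨hle, hs⟩
  exact h r (ht.trans_le hr.1) hr0

theorem dotProduct_mulVec_self_of_skew {n : Type*} [Fintype n] {S : Matrix n n ℝ} (hS : Sᵀ = -S)
    (x : n → ℝ) : x ⬝ᵥ S *ᵥ x = 0 := by
  have : x ⬝ᵥ S *ᵥ x = -(x ⬝ᵥ S *ᵥ x) := by
    conv_lhs => rw [Matrix.dotProduct_mulVec, ← Matrix.mulVec_transpose, hS, Matrix.neg_mulVec,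
      neg_dotProduct, dotProduct_comm]
  linarith

theorem det_sub_pos_of_skew {n : Type*} [Fintype n] [DecidableEq n] {S : Matrix n n ℝ}
    (hS : Sᵀ = -S) {t : ℝ} (ht : 0 < t) : 0 < (Matrix.scalar n t - S).det := by
  rw [← Matrix.eval_charpoly]
  refine S.charpoly_monic.eval_pos_of_forall_ne_zero (fun s hs h0 => ?_) ht
  rw [Matrix.eval_charpoly] at h0
  obtain ⟨x, hx, hSx⟩ := Matrix.exists_mulVec_eq_zero_iff.2 h0
  have h1 : S *ᵥ x = s • x := by
    rw [Matrix.sub_mulVec, sub_eq_zero] at hSx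
    rw [← hSx]
    ext i
    simp [Matrix.scalar_apply, Matrix.mulVec_diagonal]
  have h2 := dotProduct_mulVec_self_of_skew hS x
  rw [h1, dotProduct_smul, smul_eq_mul] at h2
  exact hx (dotProduct_self_eq_zero.1 ((mul_eq_zero.1 h2).resolve_left hs.ne'))

/-- Without positive eigenvalues, a Minkowski-skew matrix has for every `t > 0` a non-spacelike
vector that it shrinks by the factor `t` at least. -/
theorem exists_small_image {n : ℕ} {F : Matrix (Fin (n + 1)) (Fin (n + 1)) ℝ}
    (hF : Fᵀ * etaMat (n + 1) = -(etaMat (n + 1) * F))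
    (hroot : ∀ t, 0 < t → F.charpoly.eval t ≠ 0) {t : ℝ} (ht : 0 < t) :
    ∃ x, ‖x‖ = 1 ∧ minkowskiForm (n + 1) x x ≤ 0 ∧ ‖F *ᵥ x‖ ≤ t := by
  set S := etaMat (n + 1) * F with hS
  have hST : Sᵀ = -S := by rw [hS, Matrix.transpose_mul, etaMat_transpose, hF]
  have hFS : F = etaMat (n + 1) * S := by rw [hS, ← mul_assoc, etaMat_mul_self, one_mul]
  let D : ℝ → Matrix (Fin (n + 1)) (Fin (n + 1)) ℝ := fun s =>
    t • Matrix.diagonal (fun i : Fin (n + 1) => if (i : ℕ) = 0 then s else 1) - S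
  have hD1 : 0 ≤ (D 1).det := by
    have : D 1 = Matrix.scalar _ t - S := by
      ext i j
      simp [D, Matrix.scalar_apply, Matrix.diagonal_apply, Matrix.one_apply]
    rw [this]
    exact (det_sub_pos_of_skew hST ht).le
  have hD0 : (D (-1)).det ≤ 0 := by
    have : D (-1) = etaMat (n + 1) * (Matrix.scalar _ t - F) := by
      rw [mul_sub, ← hS]
      simp only [D, etaMat]
      congr 1
      ext i j
      simp [Matrix.scalar_apply, Matrix.diagonal_apply, mul_comm]
    rw [this, Matrix.det_mul, etaMat_det, ← Matrix.eval_charpoly]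
    have := F.charpoly_monic.eval_pos_of_forall_ne_zero hroot ht
    linarith
  have hcont : Continuous fun s => (D s).det := by
    have hd : Continuous fun s : ℝ =>
        Matrix.diagonal (fun i : Fin (n + 1) => if (i : ℕ) = 0 then s else (1 : ℝ)) := by
      refine Continuous.matrix_diagonal (continuous_pi fun i => ?_)
      split_ifs <;> fun_prop
    exact Continuous.matrix_det ((hd.const_smul t).sub continuous_const)
  obtain ⟨s, hs, hs0⟩ := intermediate_value_Icc (by norm_num : (-1 : ℝ) ≤ 1) hcont.continuousOn
    ⟨hD0, hD1⟩
  obtain ⟨x, hx, hDx⟩ := Matrix.exists_mulVec_eq_zero_iff.2 hs0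
  have hSx : S *ᵥ x = fun i : Fin (n + 1) => t * ((if (i : ℕ) = 0 then s else 1) * x i) := by
    rw [Matrix.sub_mulVec, sub_eq_zero, Matrix.smul_mulVec] at hDx
    rw [← hDx]
    ext i
    simp [Matrix.mulVec_diagonal]
  have hxx : s * (x 0 * x 0) + ∑ i : Fin n, x i.succ * x i.succ = 0 := by
    have h := dotProduct_mulVec_self_of_skew hST x
    rw [hSx] at h
    have h' : t * (s * (x 0 * x 0) + ∑ i : Fin n, x i.succ * x i.succ) = 0 := by
      rw [← h]
      simp only [dotProduct, Fin.sum_univ_succ, mul_add, Finset.mul_sum]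
      simp
      congr 1
      · ring
      · exact Finset.sum_congr rfl fun i _ => by ring
    exact (mul_eq_zero.1 h').resolve_left ht.ne'
  have hle : minkowskiForm (n + 1) x x ≤ 0 := by
    rw [minkowskiForm_apply]
    nlinarith [hs.1, mul_self_nonneg (x 0)]
  have hFx : ‖F *ᵥ x‖ ≤ t * ‖x‖ := by
    rw [pi_norm_le_iff_of_nonneg (by positivity)]
    intro i
    have hs1 : |s| ≤ 1 := abs_le.2 hs
    rw [hFS, ← Matrix.mulVec_mulVec, hSx, etaMat, Matrix.mulVec_diagonal]
    have hxi := norm_le_pi_norm x i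
    rw [Real.norm_eq_abs] at hxi ⊢
    simp only [abs_mul, abs_of_pos ht]
    have h1 : |(if (i : ℕ) = 0 then (-1 : ℝ) else 1)| = 1 := by split_ifs <;> simp
    have h2 : |(if (i : ℕ) = 0 then s else 1)| ≤ 1 := by split_ifs <;> simp [hs1]
    rw [h1, one_mul]
    refine mul_le_mul_of_nonneg_left ?_ ht.le
    calc _ ≤ 1 * |x i| := by gcongr
      _ ≤ ‖x‖ := by rwa [one_mul]
  have hn : 0 < ‖x‖ := norm_pos_iff.2 hx
  refine ⟨‖x‖⁻¹ • x, ?_, ?_, ?_⟩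
  · rw [norm_smul, norm_inv, norm_norm, inv_mul_cancel₀ hn.ne']
  · simp only [map_smul, LinearMap.smul_apply, smul_eq_mul]
    rw [← mul_assoc]
    exact mul_nonpos_of_nonneg_of_nonpos (by positivity) hle
  · rw [Matrix.mulVec_smul, norm_smul, norm_inv, norm_norm, inv_mul_le_iff₀ hn]
    linarith

/-- A Minkowski-skew matrix without positive eigenvalues annihilates a non-spacelike vector. -/
theorem exists_nonspacelike_ker {n : ℕ} {F : Matrix (Fin (n + 1)) (Fin (n + 1)) ℝ}
    (hF : Fᵀ * etaMat (n + 1) = -(etaMat (n + 1) * F))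
    (hroot : ∀ t, 0 < t → F.charpoly.eval t ≠ 0) :
    ∃ x, x ≠ 0 ∧ minkowskiForm (n + 1) x x ≤ 0 ∧ F *ᵥ x = 0 := by
  have hc : Continuous fun x : Fin (n + 1) → ℝ => minkowskiForm (n + 1) x x := by
    simp only [minkowskiForm_apply]
    fun_prop
  have hK : IsCompact (Metric.sphere (0 : Fin (n + 1) → ℝ) 1 ∩
      {x | minkowskiForm (n + 1) x x ≤ 0}) :=
    (isCompact_sphere _ _).inter_right (isClosed_le hc continuous_const)
  obtain ⟨x₁, hx₁, hx₁', -⟩ := exists_small_image hF hroot one_pos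
  obtain ⟨x, hx, hmin⟩ := hK.exists_isMinOn (f := fun x => ‖F *ᵥ x‖) ⟨x₁, by simpa using hx₁, hx₁'⟩
    (by fun_prop)
  refine ⟨x, ?_, hx.2, ?_⟩
  · rintro rfl
    simpa using hx.1
  · rw [← norm_eq_zero]
    refine le_antisymm (le_of_forall_pos_le_add fun t ht => ?_) (norm_nonneg _)
    obtain ⟨y, hy, hy', hFy⟩ := exists_small_image hF hroot ht
    have := hmin (a := y) ⟨by simpa using hy, hy'⟩
    rw [zero_add]
    exact le_trans this hFy

/-- `P` is a basis with Gram matrix `G ⊕ 1` in which `F` is represented by `N ⊕ A`, where `A` is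
skew-symmetric. -/
structure IsAdaptedFrame {d m : ℕ} {ι : Type*} [Fintype ι] [DecidableEq ι]
    (F : Matrix (Fin d) (Fin d) ℝ) (G N : Matrix ι ι ℝ) (P : Matrix (Fin d) (ι ⊕ Fin m) ℝ)
    (A : Matrix (Fin m) (Fin m) ℝ) : Prop where
  card : Fintype.card ι + m = d
  gram : Pᵀ * etaMat d * P = Matrix.fromBlocks G 0 0 1
  intertwine : F * P = P * Matrix.fromBlocks N 0 0 A
  skew : Aᵀ = -A

theorem exists_isAdaptedFrame {n : ℕ} {F : Matrix (Fin (n + 1)) (Fin (n + 1)) ℝ}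
    (hF : Fᵀ * etaMat (n + 1) = -(etaMat (n + 1) * F)) {ι : Type*} [Fintype ι] [DecidableEq ι]
    {G N : Matrix ι ι ℝ} (hG : G.det ≠ 0) (w : ι → Fin (n + 1) → ℝ)
    (hN : ∀ j, Matrix.toLin' F (w j) = ∑ i, N i j • w i)
    (hw : ∀ i j, minkowskiForm (n + 1) (w i) (w j) = G i j) {v : Fin (n + 1) → ℝ}
    (hv : v ∈ Submodule.span ℝ (Set.range w)) (hvv : minkowskiForm (n + 1) v v < 0) :
    ∃ (m : ℕ) (P : Matrix (Fin (n + 1)) (ι ⊕ Fin m) ℝ) (A : Matrix (Fin m) (Fin m) ℝ),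
      IsAdaptedFrame F G N P A := by
  have hB := isLorentzian_minkowskiForm n
  have hG' : (Matrix.of fun i j => minkowskiForm (n + 1) (w i) (w j)) = G := by
    ext i j
    exact hw i j
  obtain ⟨m, b, A, hcard, hwb, hbb, hfb, hA⟩ := hB.exists_complement
    (minkowskiForm_toLin'_left hF) w N hN (by rwa [hG']) hv hvv
  refine ⟨m, (Matrix.of (Sum.elim w b))ᵀ, A, by simpa using hcard, ?_, ?_, hA⟩
  · have h (k l) : ((Matrix.of (Sum.elim w b))ᵀᵀ * etaMat (n + 1) * (Matrix.of (Sum.elim w b))ᵀ) k l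
        = minkowskiForm (n + 1) (Sum.elim w b k) (Sum.elim w b l) := by
      rw [minkowskiForm_apply', Matrix.mul_assoc]
      rfl
    ext k l
    rw [h]
    rcases k with i | i <;> rcases l with j | j
    · simp [hw]
    · simp [hwb]
    · simp [hB.symm (b i), hwb]
    · simp [hbb, Matrix.one_apply]
  · have h (k l) : (F * (Matrix.of (Sum.elim w b))ᵀ) k l = Matrix.toLin' F (Sum.elim w b l) k := rfl
    ext k l
    rw [h]
    rcases l with j | j
    · simp [hN, Matrix.mul_apply, mul_comm]
    · simp [hfb, Matrix.mul_apply, mul_comm]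

namespace IsAdaptedFrame

variable {d m : ℕ} {ι : Type*} [Fintype ι] [DecidableEq ι] {F : Matrix (Fin d) (Fin d) ℝ}
  {G N : Matrix ι ι ℝ} {P : Matrix (Fin d) (ι ⊕ Fin m) ℝ} {A : Matrix (Fin m) (Fin m) ℝ}

theorem exists_inverse (h : IsAdaptedFrame F G N P A) (hG : G.det ≠ 0) :
    ∃ Q : Matrix (ι ⊕ Fin m) (Fin d) ℝ, Q * P = 1 ∧ P * Q = 1 := by
  have hQ : ((Matrix.fromBlocks G⁻¹ 0 0 1 : Matrix (ι ⊕ Fin m) (ι ⊕ Fin m) ℝ) * Pᵀ * etaMat d) * P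
      = 1 := by
    rw [Matrix.mul_assoc, Matrix.mul_assoc, ← Matrix.mul_assoc Pᵀ, h.gram,
      Matrix.fromBlocks_multiply]
    simp [Matrix.nonsing_inv_mul _ hG.isUnit]
  exact ⟨_, hQ, (Matrix.mul_eq_one_comm_of_card_eq _ _ _ (by simp [h.card])).1 hQ⟩

theorem charpoly_eq (h : IsAdaptedFrame F G N P A) (hG : G.det ≠ 0) :
    F.charpoly = N.charpoly * A.charpoly := by
  obtain ⟨Q, hQP, hPQ⟩ := h.exists_inverse hG
  have hFQ : F = P * (Matrix.fromBlocks N 0 0 A * Q) := by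
    rw [← Matrix.mul_assoc, ← h.intertwine, Matrix.mul_assoc, hPQ, Matrix.mul_one]
  have hcard : Fintype.card (ι ⊕ Fin m) = Fintype.card (Fin d) := by simp [h.card]
  rw [hFQ, Matrix.charpoly_mul_comm_of_le _ _ hcard.le, hcard, Nat.sub_self, pow_zero, one_mul,
    Matrix.mul_assoc, hQP, Matrix.mul_one, Matrix.charpoly_fromBlocks_zero₁₂]

theorem rank_eq (h : IsAdaptedFrame F G N P A) (hG : G.det ≠ 0) :
    F.rank = N.rank + A.rank := by
  obtain ⟨Q, hQP, hPQ⟩ := h.exists_inverse hG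
  rw [← rank_fromBlocks_diag]
  have hFQ : F = P * (Matrix.fromBlocks N 0 0 A * Q) := by
    rw [← Matrix.mul_assoc, ← h.intertwine, Matrix.mul_assoc, hPQ, Matrix.mul_one]
  have hMQ : Matrix.fromBlocks N 0 0 A = Q * (F * P) := by
    rw [h.intertwine, ← Matrix.mul_assoc, hQP, Matrix.one_mul]
  apply le_antisymm
  · conv_lhs => rw [hFQ]
    exact (Matrix.rank_mul_le_right _ _).trans (Matrix.rank_mul_le_left _ _)
  · conv_lhs => rw [hMQ]
    exact (Matrix.rank_mul_le_right _ _).trans (Matrix.rank_mul_le_left _ _)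

/-- Matrices with the same characteristic polynomial and frames of the same type are conjugate by
a Lorentz transformation. -/
theorem exists_lorentz {m' : ℕ} {F' : Matrix (Fin d) (Fin d) ℝ}
    {P' : Matrix (Fin d) (ι ⊕ Fin m') ℝ} {A' : Matrix (Fin m') (Fin m') ℝ}
    (h : IsAdaptedFrame F G N P A) (h' : IsAdaptedFrame F' G N P' A') (hG : G.det ≠ 0)
    (hFF' : F.charpoly = F'.charpoly) :
    ∃ L : Matrix (Fin d) (Fin d) ℝ, Lᵀ * etaMat d * L = etaMat d ∧ L * F = F' * L := by
  obtain rfl : m = m' := Nat.add_left_cancel (h.card.trans h'.card.symm)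
  obtain ⟨Q, hQP, hPQ⟩ := h.exists_inverse hG
  have hA : A.charpoly = A'.charpoly := by
    rw [h.charpoly_eq hG, h'.charpoly_eq hG] at hFF'
    exact mul_left_cancel₀ N.charpoly_monic.ne_zero hFF'
  obtain ⟨O, hO, hOA⟩ := exists_orthogonal_of_charpoly_eq h.skew h'.skew hA
  set R : Matrix (ι ⊕ Fin m) (ι ⊕ Fin m) ℝ := Matrix.fromBlocks 1 0 0 O with hR
  have hRG : Rᵀ * Matrix.fromBlocks G 0 0 1 * R = Matrix.fromBlocks G 0 0 1 := by
    simp [hR, Matrix.fromBlocks_transpose, Matrix.fromBlocks_multiply, hO]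
  have hRN : R * Matrix.fromBlocks N 0 0 A = Matrix.fromBlocks N 0 0 A' * R := by
    simp [hR, Matrix.fromBlocks_multiply, hOA]
  refine ⟨P' * R * Q, ?_, ?_⟩
  · calc (P' * R * Q)ᵀ * etaMat d * (P' * R * Q)
        = Qᵀ * (Rᵀ * (P'ᵀ * etaMat d * P') * R) * Q := by
          simp only [Matrix.transpose_mul, Matrix.mul_assoc]
      _ = (P * Q)ᵀ * etaMat d * (P * Q) := by
          rw [h'.gram, hRG, ← h.gram]
          simp only [Matrix.transpose_mul, Matrix.mul_assoc]
      _ = etaMat d := by rw [hPQ, Matrix.transpose_one, Matrix.one_mul, Matrix.mul_one]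
  · calc P' * R * Q * F = P' * R * (Q * (F * P) * Q) := by
          simp only [Matrix.mul_assoc, hPQ, Matrix.mul_one]
      _ = P' * (R * Matrix.fromBlocks N 0 0 A) * Q := by
          rw [h.intertwine, ← Matrix.mul_assoc Q, hQP, Matrix.one_mul]
          simp only [Matrix.mul_assoc]
      _ = F' * (P' * R * Q) := by
          rw [hRN, ← Matrix.mul_assoc, ← h'.intertwine]
          simp only [Matrix.mul_assoc]

end IsAdaptedFrame

/-- A Minkowski-skew matrix that annihilates a timelike vector has a frame with a trivial
one-dimensional Lorentzian block. -/
theorem exists_isAdaptedFrame_timelike {n : ℕ} {F : Matrix (Fin (n + 1)) (Fin (n + 1)) ℝ}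
    (hF : Fᵀ * etaMat (n + 1) = -(etaMat (n + 1) * F)) {v : Fin (n + 1) → ℝ}
    (hv : Matrix.toLin' F v = 0) (hvv : minkowskiForm (n + 1) v v < 0) :
    ∃ (m : ℕ) (P : Matrix (Fin (n + 1)) (Fin 1 ⊕ Fin m) ℝ) (A : Matrix (Fin m) (Fin m) ℝ),
      IsAdaptedFrame F !![-1] 0 P A := by
  set q := -minkowskiForm (n + 1) v v with hq
  have hq0 : 0 < q := by linarith
  have hc : (√q)⁻¹ * ((√q)⁻¹ * minkowskiForm (n + 1) v v) = -1 := by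
    rw [← mul_assoc, ← mul_inv, Real.mul_self_sqrt hq0.le]
    field_simp
    linarith
  refine exists_isAdaptedFrame hF (by simp) (fun _ => (√q)⁻¹ • v) ?_ ?_
    (Submodule.subset_span ⟨0, rfl⟩) ?_
  · simp [hv]
  · intro i j
    fin_cases i; fin_cases j
    simpa using hc
  · simp [hc]

/-- A Minkowski-skew matrix with a nonzero real eigenvalue has a frame with a boost block. -/
theorem exists_isAdaptedFrame_boost {n : ℕ} {F : Matrix (Fin (n + 1)) (Fin (n + 1)) ℝ}
    (hF : Fᵀ * etaMat (n + 1) = -(etaMat (n + 1) * F)) {l : ℝ} (hl : l ≠ 0)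
    (hroot : F.charpoly.eval l = 0) :
    ∃ (m : ℕ) (P : Matrix (Fin (n + 1)) (Fin 2 ⊕ Fin m) ℝ) (A : Matrix (Fin m) (Fin m) ℝ),
      IsAdaptedFrame F !![0, -1; -1, 0] !![l, 0; 0, -l] P A := by
  rw [Matrix.eval_charpoly] at hroot
  have hscalar (x : Fin (n + 1) → ℝ) : Matrix.scalar (Fin (n + 1)) l *ᵥ x = l • x := by
    ext i
    simp [Matrix.scalar_apply, Matrix.mulVec_diagonal]
  obtain ⟨x, hx0, hx⟩ := Matrix.exists_mulVec_eq_zero_iff.2 hroot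
  obtain ⟨y, hy0, hy⟩ := Matrix.exists_vecMul_eq_zero_iff.2 hroot
  rw [Matrix.sub_mulVec, sub_eq_zero, hscalar] at hx
  rw [← Matrix.mulVec_transpose, Matrix.transpose_sub, Matrix.sub_mulVec, sub_eq_zero] at hy
  have hy' : Fᵀ *ᵥ y = l • y := by
    rw [← hy, ← hscalar]
    simp [Matrix.scalar_apply]
  have hyy (y) : etaMat (n + 1) *ᵥ (etaMat (n + 1) *ᵥ y) = y := by
    rw [Matrix.mulVec_mulVec, etaMat_mul_self, Matrix.one_mulVec]
  have hFy : F *ᵥ (etaMat (n + 1) *ᵥ y) = -l • (etaMat (n + 1) *ᵥ y) := by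
    have h1 : etaMat (n + 1) *ᵥ (F *ᵥ (etaMat (n + 1) *ᵥ y)) = -l • y := by
      rw [Matrix.mulVec_mulVec, ← neg_neg (etaMat (n + 1) * F), ← hF, Matrix.neg_mulVec,
        ← Matrix.mulVec_mulVec, hyy, hy', neg_smul]
    rw [← hyy (F *ᵥ _), h1, Matrix.mulVec_smul]
  obtain ⟨w, h0, h1, h00, h11, h01⟩ := (isLorentzian_minkowskiForm n).exists_boost_frame
    (minkowskiForm_toLin'_left hF) hl hx0 (m := etaMat (n + 1) *ᵥ y)
    (by rintro h; exact hy0 (by rw [← hyy y, h, Matrix.mulVec_zero])) hx.symm hFy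
  have h10 : minkowskiForm (n + 1) (w 1) (w 0) = -1 := by
    rw [(isLorentzian_minkowskiForm n).symm, h01]
  refine exists_isAdaptedFrame hF (by simp [Matrix.det_fin_two]) w ?_ ?_ (v := w 0 + w 1)
    (add_mem (Submodule.subset_span ⟨0, rfl⟩) (Submodule.subset_span ⟨1, rfl⟩)) ?_
  · rw [Fin.forall_fin_two]
    simpa [Fin.sum_univ_two] using ⟨h0, h1.trans (neg_smul _ _)⟩
  · simp [Fin.forall_fin_two, h00, h01, h10, h11]
  · simp [h00, h01, h10, h11]

/-- A Minkowski-skew matrix whose kernel contains a null vector but no timelike vector has a frame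
with a null rotation block. -/
theorem exists_isAdaptedFrame_nullRotation {n : ℕ} {F : Matrix (Fin (n + 1)) (Fin (n + 1)) ℝ}
    (hF : Fᵀ * etaMat (n + 1) = -(etaMat (n + 1) * F))
    (hker : ∀ k, Matrix.toLin' F k = 0 → 0 ≤ minkowskiForm (n + 1) k k) {x : Fin (n + 1) → ℝ}
    (hx0 : x ≠ 0) (hx : Matrix.toLin' F x = 0) (hxx : minkowskiForm (n + 1) x x = 0) :
    ∃ (m : ℕ) (P : Matrix (Fin (n + 1)) (Fin 3 ⊕ Fin m) ℝ) (A : Matrix (Fin m) (Fin m) ℝ),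
      IsAdaptedFrame F !![0, 0, -1; 0, 1, 0; -1, 0, 0] !![0, 1, 0; 0, 0, 1; 0, 0, 0] P A := by
  have hB := isLorentzian_minkowskiForm n
  obtain ⟨w, h0, h1, h2, h00, h01, h02, h11, h12, h22⟩ :=
    hB.exists_nullRotation_frame (minkowskiForm_toLin'_left hF) hker hx0 hx hxx
  have h10 := (hB.symm (w 1) (w 0)).trans h01
  have h20 := (hB.symm (w 2) (w 0)).trans h02
  have h21 := (hB.symm (w 2) (w 1)).trans h12
  refine exists_isAdaptedFrame hF (by simp [Matrix.det_fin_three]) w ?_ ?_ (v := w 0 + w 2)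
    (add_mem (Submodule.subset_span ⟨0, rfl⟩) (Submodule.subset_span ⟨2, rfl⟩)) ?_
  · intro j
    fin_cases j <;> simp [Fin.sum_univ_three, h0, h1, h2]
  · intro i j
    fin_cases i <;> fin_cases j <;> simp [h00, h01, h02, h10, h11, h12, h20, h21, h22]
  · simp [h00, h02, h20, h22]

/-- Trivial and null rotation blocks are told apart by characteristic polynomial and rank. -/
theorem not_timelike_of_nullRotation {d m m' : ℕ} {F F' : Matrix (Fin d) (Fin d) ℝ}
    {P : Matrix (Fin d) (Fin 1 ⊕ Fin m) ℝ} {P' : Matrix (Fin d) (Fin 3 ⊕ Fin m') ℝ}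
    {A : Matrix (Fin m) (Fin m) ℝ} {A' : Matrix (Fin m') (Fin m') ℝ}
    (h : IsAdaptedFrame F !![-1] 0 P A)
    (h' : IsAdaptedFrame F' !![0, 0, -1; 0, 1, 0; -1, 0, 0] !![0, 1, 0; 0, 0, 1; 0, 0, 0] P' A')
    (hchar : F.charpoly = F'.charpoly) (hrank : F.rank = F'.rank) : False := by
  have hG : (!![-1] : Matrix (Fin 1) (Fin 1) ℝ).det ≠ 0 := by simp
  have hG' : (!![0, 0, -1; 0, 1, 0; -1, 0, 0] : Matrix (Fin 3) (Fin 3) ℝ).det ≠ 0 := by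
    simp [Matrix.det_fin_three]
  have hN : (!![0, 1, 0; 0, 0, 1; 0, 0, 0] : Matrix (Fin 3) (Fin 3) ℝ).charpoly =
      Polynomial.X ^ 3 := by
    simp [Matrix.charpoly, Matrix.charmatrix, Matrix.det_fin_three]
    ring
  have hA : A.charpoly = (Matrix.fromBlocks (0 : Matrix (Fin 2) (Fin 2) ℝ) 0 0 A').charpoly := by
    rw [h.charpoly_eq hG, h'.charpoly_eq hG', hN, Matrix.charpoly_zero] at hchar
    rw [Matrix.charpoly_fromBlocks_zero₁₂, Matrix.charpoly_zero]
    refine mul_left_cancel₀ (Polynomial.X_ne_zero (R := ℝ)) ?_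
    simp only [Fintype.card_fin, pow_one] at hchar ⊢
    rw [hchar]
    ring
  have hr := rank_eq_of_charpoly_eq h.skew
    (by rw [Matrix.fromBlocks_transpose, h'.skew]; simp [Matrix.fromBlocks_neg]) hA
  rw [rank_fromBlocks_diag, Matrix.rank_zero, zero_add] at hr
  rw [h.rank_eq hG, h'.rank_eq hG', Matrix.rank_zero, hr] at hrank
  have hN0 : (!![0, 1, 0; 0, 0, 1; 0, 0, 0] : Matrix (Fin 3) (Fin 3) ℝ).rank = 0 := by omega
  rw [Matrix.rank, Submodule.finrank_eq_zero, LinearMap.range_eq_bot] at hN0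
  simpa [Matrix.mulVec, dotProduct, Fin.sum_univ_three] using
    congrFun (LinearMap.congr_fun hN0 ![0, 1, 0]) 0

/-- A Minkowski-skew matrix without nonzero real eigenvalues has a frame with a trivial block or a
null rotation block. -/
theorem exists_isAdaptedFrame_of_forall_ne_zero {n : ℕ}
    {F : Matrix (Fin (n + 1)) (Fin (n + 1)) ℝ}
    (hF : Fᵀ * etaMat (n + 1) = -(etaMat (n + 1) * F))
    (hroot : ∀ t, 0 < t → F.charpoly.eval t ≠ 0) :
    (∃ (m : ℕ) (P : Matrix (Fin (n + 1)) (Fin 1 ⊕ Fin m) ℝ) (A : Matrix (Fin m) (Fin m) ℝ),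
      IsAdaptedFrame F !![-1] 0 P A) ∨
    ∃ (m : ℕ) (P : Matrix (Fin (n + 1)) (Fin 3 ⊕ Fin m) ℝ) (A : Matrix (Fin m) (Fin m) ℝ),
      IsAdaptedFrame F !![0, 0, -1; 0, 1, 0; -1, 0, 0] !![0, 1, 0; 0, 0, 1; 0, 0, 0] P A := by
  by_cases h : ∃ v, Matrix.toLin' F v = 0 ∧ minkowskiForm (n + 1) v v < 0
  · obtain ⟨v, hv, hvv⟩ := h
    exact Or.inl (exists_isAdaptedFrame_timelike hF hv hvv)
  · push Not at h
    obtain ⟨x, hx0, hxx, hx⟩ := exists_nonspacelike_ker hF hroot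
    exact Or.inr (exists_isAdaptedFrame_nullRotation hF h hx0 hx (hxx.antisymm (h x hx)))

theorem exists_lorentz_of_charpoly_eq {n : ℕ} {F F' : Matrix (Fin (n + 1)) (Fin (n + 1)) ℝ}
    (hF : Fᵀ * etaMat (n + 1) = -(etaMat (n + 1) * F))
    (hF' : F'ᵀ * etaMat (n + 1) = -(etaMat (n + 1) * F'))
    (hchar : F.charpoly = F'.charpoly) (hrank : F.rank = F'.rank) :
    ∃ L : Matrix (Fin (n + 1)) (Fin (n + 1)) ℝ,
      Lᵀ * etaMat (n + 1) * L = etaMat (n + 1) ∧ L * F = F' * L := by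
  by_cases hroot : ∃ l, 0 < l ∧ F.charpoly.eval l = 0
  · obtain ⟨l, hl, hr⟩ := hroot
    obtain ⟨m, P, A, h⟩ := exists_isAdaptedFrame_boost hF hl.ne' hr
    obtain ⟨m', P', A', h'⟩ := exists_isAdaptedFrame_boost hF' hl.ne' (hchar ▸ hr)
    exact h.exists_lorentz h' (by simp [Matrix.det_fin_two]) hchar
  · push Not at hroot
    rcases exists_isAdaptedFrame_of_forall_ne_zero hF hroot with ⟨m, P, A, h⟩ | ⟨m, P, A, h⟩ <;>
    rcases exists_isAdaptedFrame_of_forall_ne_zero hF' (hchar ▸ hroot) with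
      ⟨m', P', A', h'⟩ | ⟨m', P', A', h'⟩
    · exact h.exists_lorentz h' (by simp) hchar
    · exact (not_timelike_of_nullRotation h h' hchar hrank).elim
    · exact (not_timelike_of_nullRotation h' h hchar.symm hrank.symm).elim
    · exact h.exists_lorentz h' (by simp [Matrix.det_fin_three]) hchar

theorem apply_zero_zero_ne_zero {n : ℕ} {L : Matrix (Fin (n + 1)) (Fin (n + 1)) ℝ}
    (hL : Lᵀ * etaMat (n + 1) * L = etaMat (n + 1)) : L 0 0 ≠ 0 := by
  intro h0
  have h : minkowskiForm (n + 1) (Lᵀ 0) (Lᵀ 0) = -1 := by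
    have : (Lᵀ * etaMat (n + 1) * L) 0 0 = -1 := by rw [hL]; simp [etaMat]
    rw [minkowskiForm_apply', ← this, Matrix.mul_assoc]
    rfl
  rw [minkowskiForm_apply] at h
  simp only [Matrix.transpose_apply, h0, mul_zero, neg_zero, zero_add] at h
  have : 0 ≤ ∑ i : Fin n, L i.succ 0 * L i.succ 0 :=
    Finset.sum_nonneg fun _ _ => mul_self_nonneg _
  linarith

theorem isUnit_det_of_lorentz {d : ℕ} {L : Matrix (Fin d) (Fin d) ℝ}
    (hL : Lᵀ * etaMat d * L = etaMat d) : IsUnit L.det := by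
  refine Matrix.isUnit_det_of_left_inverse (B := etaMat d * (Lᵀ * etaMat d)) ?_
  rw [Matrix.mul_assoc, hL, etaMat_mul_self]

/-- Two Minkowski-skew-symmetric matrices have the same characteristic
polynomial and the same rank iff they are conjugate by an orthochronous
Lorentz transformation. -/
theorem stmt17 (d : ℕ) (hd : 2 ≤ d)
    (F Ft : Matrix (Fin d) (Fin d) ℝ)
    (hF : Fᵀ * etaMat d = -(etaMat d * F))
    (hFt : Ftᵀ * etaMat d = -(etaMat d * Ft)) :
    (F.charpoly = Ft.charpoly ∧ F.rank = Ft.rank) ↔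
    (∃ Λ : Matrix (Fin d) (Fin d) ℝ,
      Λᵀ * etaMat d * Λ = etaMat d ∧
      0 < Λ ⟨0, by omega⟩ ⟨0, by omega⟩ ∧
      Ft = Λ * F * Λ⁻¹) := by
  obtain ⟨n, rfl⟩ : ∃ n, d = n + 1 := ⟨d - 1, by omega⟩
  constructor
  · rintro ⟨hchar, hrank⟩
    obtain ⟨L, hL, hLF⟩ := exists_lorentz_of_charpoly_eq hF hFt hchar hrank
    have hconj {M : Matrix (Fin (n + 1)) (Fin (n + 1)) ℝ}
        (hM : Mᵀ * etaMat (n + 1) * M = etaMat (n + 1)) (hMF : M * F = Ft * M) :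
        Ft = M * F * M⁻¹ := by
      rw [hMF, Matrix.mul_assoc, Matrix.mul_nonsing_inv _ (isUnit_det_of_lorentz hM),
        Matrix.mul_one]
    rcases (apply_zero_zero_ne_zero hL).lt_or_gt with h0 | h0
    · have hL' : (-L)ᵀ * etaMat (n + 1) * -L = etaMat (n + 1) := by
        rw [Matrix.transpose_neg, Matrix.neg_mul, Matrix.neg_mul, Matrix.mul_neg, neg_neg, hL]
      exact ⟨-L, hL', neg_pos.2 h0, hconj hL' (by rw [Matrix.neg_mul, hLF, Matrix.mul_neg])⟩
    · exact ⟨L, hL, h0, hconj hL hLF⟩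
  · rintro ⟨L, hL, -, rfl⟩
    have hu := isUnit_det_of_lorentz hL
    constructor
    · rw [Matrix.charpoly_mul_comm, ← Matrix.mul_assoc, Matrix.nonsing_inv_mul _ hu,
        Matrix.one_mul]
    · rw [Matrix.rank_mul_eq_left_of_isUnit_det _ _ (by simpa using hu),
        Matrix.rank_mul_eq_right_of_isUnit_det _ _ hu]
end

section
/- Let F be a nonzero skew-symmetric endomorphism of Minkowski space 𝕄^{1,d-1}, let q := ⌊d/2⌋, let r := (rank F)/2 (the rank of F is even), and for 1 ≤ b ≤ q let c_b denote the coefficient of X^{d-2b} in the characteristic polynomial of F. Then: (1) c_r > 0 if and only if ker F contains a timelike vector; (2) c_r = 0 if and only if the restriction of η to ker F is degenerate (there exists a nonzero w ∈ ker F with η(w,u) = 0 for all u ∈ ker F); (3) c_r < 0 if and only if the restriction of η to ker F is positive definite (which includes the case ker F = {0}). Moreover, if r < q then c_b = 0 for every b with r < b ≤ q. -/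
open scoped BigOperators

/-- The Minkowski bilinear form on `ℝ^d`. -/
noncomputable def mink (d : ℕ) (x y : Fin d → ℝ) : ℝ :=
  ∑ i : Fin d, (if (i : ℕ) = 0 then (-1 : ℝ) else 1) * x i * y i

/-- Skew-symmetry w.r.t. the Minkowski form. -/
def IsSkew (d : ℕ) (F : (Fin d → ℝ) →ₗ[ℝ] (Fin d → ℝ)) : Prop :=
  ∀ x y, mink d (F x) y = - mink d x (F y)

open LinearMap (BilinForm)
open Module (finrank)

namespace Matrix

variable {n : Type*} [Fintype n] [DecidableEq n]

theorem even_card_of_transpose_eq_neg {A : Matrix n n ℝ} (hA : Aᵀ = -A) (hdet : A.det ≠ 0) :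
    Even (Fintype.card n) := by
  by_contra hodd
  rw [Nat.not_even_iff_odd] at hodd
  have h := A.det_transpose
  rw [hA, det_neg, hodd.neg_one_pow] at h
  exact hdet (by linarith)

theorem det_pos_of_transpose_eq_neg {A : Matrix n n ℝ} (hA : Aᵀ = -A) (hdet : A.det ≠ 0) :
    0 < A.det := by
  have heven := even_card_of_transpose_eq_neg hA hdet
  have hzero : A.charpoly.eval 0 = A.det := by
    rw [det_eq_sign_charpoly_coeff, heven.neg_one_pow, one_mul, Polynomial.coeff_zero_eq_eval_zero]
  have hne (t : ℝ) (ht : 0 < t) : A.charpoly.eval t ≠ 0 := by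
    rw [eval_charpoly]
    intro h
    obtain ⟨v, hv, hv0⟩ := exists_mulVec_eq_zero_iff.mpr h
    have hskew : v ⬝ᵥ A *ᵥ v = 0 := by
      have h1 : v ⬝ᵥ A *ᵥ v = v ⬝ᵥ Aᵀ *ᵥ v := by
        rw [mulVec_transpose, dotProduct_mulVec, dotProduct_comm]
      rw [hA, neg_mulVec, dotProduct_neg] at h1
      linarith
    have h2 : v ⬝ᵥ (scalar n t - A) *ᵥ v = t * (v ⬝ᵥ v) := by
      rw [sub_mulVec, dotProduct_sub, hskew, scalar_apply, ← smul_one_eq_diagonal, smul_mulVec,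
        one_mulVec, dotProduct_smul, smul_eq_mul, sub_zero]
    rw [hv0, dotProduct_zero] at h2
    exact hv (dotProduct_self_eq_zero.mp ((mul_eq_zero.mp h2.symm).resolve_left ht.ne'))
  by_contra! hneg
  have hlt : A.charpoly.eval 0 < 0 := hzero ▸ lt_of_le_of_ne hneg hdet
  obtain ⟨T, hT, hT0⟩ : ∃ T, 0 < A.charpoly.eval T ∧ (0 : ℝ) < T := by
    cases isEmpty_or_nonempty n
    · exact ⟨1, by simp, one_pos⟩
    · have hdeg : 0 < A.charpoly.degree := by
        rw [← Polynomial.natDegree_pos_iff_degree_pos, charpoly_natDegree_eq_dim]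
        exact Fintype.card_pos
      have htend := A.charpoly.tendsto_atTop_of_leadingCoeff_nonneg hdeg
        (by rw [A.charpoly_monic.leadingCoeff]; exact zero_le_one)
      exact ((htend.eventually_gt_atTop 0).and (Filter.eventually_gt_atTop 0)).exists
  obtain ⟨t, ht, ht0⟩ := intermediate_value_Ioo hT0.le A.charpoly.continuous.continuousOn
    (show (0 : ℝ) ∈ Set.Ioo _ _ from ⟨hlt, hT⟩)
  exact hne t ht.1 ht0

end Matrix

namespace LinearMap.BilinForm

open Matrix

variable {V ι : Type*} [AddCommGroup V] [Module ℝ V] [Fintype ι] [DecidableEq ι]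

theorem dotProduct_toMatrix_mulVec_repr (B : BilinForm ℝ V) (b : Module.Basis ι ℝ V) (x y : V) :
    b.repr x ⬝ᵥ (BilinForm.toMatrix b B *ᵥ b.repr y) = B x y := by
  rw [dotProduct_toMatrix_mulVec]
  simp [Module.Basis.equivFun_symm_apply, b.sum_repr]

theorem transpose_toMatrix_of_isAlt {B : BilinForm ℝ V} (hB : B.IsAlt)
    (b : Module.Basis ι ℝ V) : (BilinForm.toMatrix b B)ᵀ = -BilinForm.toMatrix b B := by
  ext i j
  simp [BilinForm.toMatrix_apply, hB.neg_eq]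

theorem isHermitian_toMatrix {B : BilinForm ℝ V} (hB : ∀ x y, B x y = B y x)
    (b : Module.Basis ι ℝ V) : (BilinForm.toMatrix b B).IsHermitian := by
  ext i j
  simp [BilinForm.toMatrix_apply, hB]

theorem det_toMatrix_pos {B : BilinForm ℝ V} (hB : ∀ x y, B x y = B y x)
    (hpos : ∀ x, x ≠ 0 → 0 < B x x) (b : Module.Basis ι ℝ V) :
    0 < (BilinForm.toMatrix b B).det := by
  refine (Matrix.PosDef.of_dotProduct_mulVec_pos (isHermitian_toMatrix hB b) fun x hx ↦ ?_).det_pos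
  rw [star_trivial, dotProduct_toMatrix_mulVec]
  exact hpos _ ((map_ne_zero_iff _ b.equivFun.symm.injective).mpr hx)

/-- If `B` is negative on `s` and positive definite on the orthogonal complement of `s`, then
flipping the sign of `B` on the line spanned by `s` turns it into a positive definite form. -/
theorem det_toMatrix_neg {B : BilinForm ℝ V} (hB : ∀ x y, B x y = B y x) {s : V}
    (hs : B s s < 0) (hpos : ∀ x, x ≠ 0 → B x s = 0 → 0 < B x x) (b : Module.Basis ι ℝ V) :
    (BilinForm.toMatrix b B).det < 0 := by
  let c : ℝ := -2 / B s s
  let C : BilinForm ℝ V := B + c • BilinForm.linMulLin (B s) (B s)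
  have hC (x y : V) : C x y = B x y + c * (B s x * B s y) := by simp [C]
  have hC_pos (x : V) (hx : x ≠ 0) : 0 < C x x := by
    let a := B x s / B s s
    let y := x - a • s
    have hys : B y s = 0 := by
      simp only [y, a, map_sub, map_smul, LinearMap.sub_apply, LinearMap.smul_apply, smul_eq_mul]
      field_simp [hs.ne]
      ring
    have hxy : x = a • s + y := by simp [y]
    have hval : C x x = -(a ^ 2 * B s s) + B y y := by
      rw [hC, hxy]
      simp only [map_add, map_smul, LinearMap.add_apply, LinearMap.smul_apply, smul_eq_mul, hys,
        hB s y, c]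
      field_simp [hs.ne]
      ring
    rw [hval]
    by_cases hy : y = 0
    · have ha : a ≠ 0 := by
        rintro ha
        exact hx (by rw [hxy, ha, hy]; simp)
      rw [hy]
      have := mul_neg_of_pos_of_neg (pow_pos (abs_pos.mpr ha) 2) hs
      rw [sq_abs] at this
      simpa using this
    · have h1 := hpos y hy hys
      have h2 := mul_nonpos_of_nonneg_of_nonpos (sq_nonneg a) hs.le
      linarith
  have hdet : (BilinForm.toMatrix b C).det = -(BilinForm.toMatrix b B).det := by
    obtain ⟨G, hGB⟩ : ∃ G, BilinForm.toMatrix b B = G := ⟨_, rfl⟩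
    let σ : ι → ℝ := b.repr s
    have hG (i : ι) : (G *ᵥ σ) i = B s (b i) := by
      rw [hB, ← dotProduct_toMatrix_mulVec_repr B b (b i) s, hGB]
      simp [σ, Finsupp.single_eq_pi_single]
    have hGs : (σ ⬝ᵥ G *ᵥ σ) = B s s := hGB ▸ dotProduct_toMatrix_mulVec_repr B b s s
    have hmat : BilinForm.toMatrix b C =
        G * (1 + replicateCol Unit (c • σ) * replicateRow Unit (G *ᵥ σ)) := by
      rw [mul_add, mul_one, ← Matrix.mul_assoc]
      ext i j
      rw [BilinForm.toMatrix_apply, hC, ← replicateCol_mulVec, mulVec_smul, Matrix.add_apply,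
        ← hGB, BilinForm.toMatrix_apply, hGB]
      simp [Matrix.mul_apply, hG, mul_assoc]
    rw [hmat, det_mul, det_one_add_replicateCol_mul_replicateRow, dotProduct_smul,
      dotProduct_comm, hGs, smul_eq_mul, div_mul_cancel₀ _ hs.ne, hGB]
    ring
  have := det_toMatrix_pos (B := C) (fun x y ↦ by rw [hC, hC, hB x y]; ring) hC_pos b
  linarith

/-- A symmetric form is Lorentzian if it has a timelike vector, and the orthogonal complement of
each timelike vector is positive definite. -/
structure IsLorentzian (B : BilinForm ℝ V) : Prop where
  symm : ∀ x y, B x y = B y x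
  exists_neg : ∃ w, B w w < 0
  pos_of_orthogonal : ∀ w, B w w < 0 → ∀ u, u ≠ 0 → B u w = 0 → 0 < B u u

theorem IsLorentzian.nondegenerate {B : BilinForm ℝ V} (hB : B.IsLorentzian) :
    B.Nondegenerate := by
  obtain ⟨w, hw⟩ := hB.exists_neg
  have h (x : V) (hx : ∀ y, B x y = 0) : x = 0 := by
    by_contra hx0
    exact (hB.pos_of_orthogonal w hw x hx0 (hx w)).ne' (hx x)
  exact ⟨h, fun x hx ↦ h x fun y ↦ hB.symm x y ▸ hx y⟩

/-- On any subspace, a symmetric form takes a negative value, is degenerate, or is positive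
definite. -/
theorem neg_or_degenerate_or_pos {B : BilinForm ℝ V} (hB : ∀ x y, B x y = B y x)
    (K : Submodule ℝ V) :
    (∃ w ∈ K, B w w < 0) ∨ (∃ w ∈ K, w ≠ 0 ∧ ∀ u ∈ K, B w u = 0) ∨
      ∀ w ∈ K, w ≠ 0 → 0 < B w w := by
  by_contra! h
  obtain ⟨hneg, hdeg, w, hwK, hw, hww⟩ := h
  obtain ⟨u, huK, hwu⟩ := hdeg w hwK hw
  have hw0 : B w w = 0 := le_antisymm hww (hneg w hwK)
  let t : ℝ := -(B u u + 1) / (2 * B w u)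
  have h := hneg (u + t • w) (K.add_mem huK (K.smul_mem t hwK))
  have hval : B (u + t • w) (u + t • w) = -1 := by
    simp only [map_add, map_smul, LinearMap.add_apply, LinearMap.smul_apply, smul_eq_mul, hw0,
      hB u w, t]
    field_simp
    ring
  linarith

variable {B : BilinForm ℝ V} {F : V →ₗ[ℝ] V}

theorem mem_ker_iff_of_skew (hB : B.Nondegenerate) (hF : ∀ x y, B (F x) y = -B x (F y)) {w : V} :
    w ∈ ker F ↔ ∀ y, B w (F y) = 0 := by
  rw [mem_ker]
  refine ⟨fun h y ↦ ?_, fun h ↦ hB.1 _ fun y ↦ by rw [hF, h, neg_zero]⟩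
  rw [← neg_eq_zero, ← hF, h, map_zero, LinearMap.zero_apply]

variable [FiniteDimensional ℝ V]

theorem mem_range_of_skew (hB : B.Nondegenerate) (hsymm : ∀ x y, B x y = B y x)
    (hF : ∀ x y, B (F x) y = -B x (F y)) {w : V} (hw : ∀ u ∈ ker F, B w u = 0) : w ∈ range F := by
  have hrefl : B.IsRefl := fun x y h ↦ hsymm x y ▸ h
  rw [← BilinForm.orthogonal_orthogonal hB hrefl (range F), BilinForm.mem_orthogonal_iff]
  intro u hu
  rw [hsymm]
  refine hw u ((mem_ker_iff_of_skew hB hF).mpr fun y ↦ ?_)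
  rw [hsymm]
  exact hu (F y) (mem_range_self F y)

/-- For a skew endomorphism `F`, the Gram matrix of `B` on `range F` is, up to a sign, the Gram
matrix of a symplectic form times the matrix of `F` restricted to `range F`. -/
theorem exists_symplectic_of_skew (hB : B.Nondegenerate) (hsymm : ∀ x y, B x y = B y x)
    (hF : ∀ x y, B (F x) y = -B x (F y)) :
    ∃ ω : BilinForm ℝ (range F), ω.IsAlt ∧ ω.Nondegenerate ∧
      B.restrict (range F) = -ω.compRight (F.rangeRestrict ∘ₗ (range F).subtype) := by
  obtain ⟨g, hg⟩ := F.rangeRestrict.exists_rightInverse_of_surjective F.range_rangeRestrict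
  have hFg (u : range F) : F (g u) = u := congrArg Subtype.val (LinearMap.congr_fun hg u)
  let ω : BilinForm ℝ (range F) := B.compl₁₂ g (range F).subtype
  have hω (u v : range F) : ω u v = B (g u) v := rfl
  have halt : ω.IsAlt := fun u ↦ by
    have h := hF (g u) (g u)
    rw [hFg, hsymm] at h
    rw [hω]
    linarith
  have hright (v : range F) (hv : ∀ u, ω u v = 0) : v = 0 := by
    obtain ⟨_, y, rfl⟩ := v
    have h : F y = 0 := by
      rw [← mem_ker, mem_ker_iff_of_skew hB hF]
      intro z
      have hz := hv (F.rangeRestrict z)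
      rw [hω, ← neg_eq_zero, ← hF, hFg] at hz
      rw [hsymm]
      exact hz
    exact Subtype.ext h
  refine ⟨ω, halt, ⟨fun u hu ↦ hright u fun v ↦ ?_, hright⟩, ?_⟩
  · rw [← halt.neg_eq, hu, neg_zero]
  · ext u v
    change B u v = -B (g u) (F v)
    rw [← hF, hFg]

theorem even_finrank_range_of_skew (hB : B.Nondegenerate) (hsymm : ∀ x y, B x y = B y x)
    (hF : ∀ x y, B (F x) y = -B x (F y)) : Even (finrank ℝ (range F)) := by
  obtain ⟨ω, halt, hnd, -⟩ := exists_symplectic_of_skew hB hsymm hF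
  have b := Module.finBasis ℝ (range F)
  simpa using even_card_of_transpose_eq_neg (transpose_toMatrix_of_isAlt halt b)
    ((nondegenerate_iff_det_ne_zero b).mp hnd)

theorem sign_det_restrict_range_of_skew (hB : B.Nondegenerate) (hsymm : ∀ x y, B x y = B y x)
    (hF : ∀ x y, B (F x) y = -B x (F y)) (b : Module.Basis ι ℝ (range F)) :
    SignType.sign (BilinForm.toMatrix b (B.restrict (range F))).det =
      SignType.sign (F.rangeRestrict ∘ₗ (range F).subtype).det := by
  obtain ⟨ω, halt, hnd, h⟩ := exists_symplectic_of_skew hB hsymm hF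
  have hskew := transpose_toMatrix_of_isAlt halt b
  have hdet := (nondegenerate_iff_det_ne_zero b).mp hnd
  have hneg : BilinForm.toMatrix b (B.restrict (range F)) =
      -BilinForm.toMatrix b (ω.compRight (F.rangeRestrict ∘ₗ (range F).subtype)) := by
    rw [h]
    ext i j
    simp [BilinForm.toMatrix_apply]
  rw [hneg, det_neg, (even_card_of_transpose_eq_neg hskew hdet).neg_one_pow, one_mul,
    toMatrix_compRight, det_mul, LinearMap.det_toMatrix, sign_mul,
    sign_pos (det_pos_of_transpose_eq_neg hskew hdet), one_mul]

end LinearMap.BilinForm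

theorem LinearMap.charpoly_eq_X_pow_mul_charpoly_range {V : Type*} [AddCommGroup V] [Module ℝ V]
    [FiniteDimensional ℝ V] (F : V →ₗ[ℝ] V) :
    F.charpoly = Polynomial.X ^ (finrank ℝ V - finrank ℝ (range F)) *
      (F.rangeRestrict ∘ₗ (range F).subtype).charpoly := by
  let b := Module.finBasis ℝ V
  let b' := Module.finBasis ℝ (range F)
  rw [← F.charpoly_toMatrix b, ← LinearMap.charpoly_toMatrix _ b', LinearMap.toMatrix_comp b' b b']
  nth_rw 1 [← F.subtype_comp_codRestrict (range F) F.mem_range_self]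
  rw [LinearMap.toMatrix_comp b b' b, Matrix.charpoly_mul_comm_of_le _ _
    (by simpa using (range F).finrank_le)]
  simp

theorem LinearMap.charpoly_coeff_zero_of_even_finrank {V : Type*} [AddCommGroup V] [Module ℝ V]
    [FiniteDimensional ℝ V] (f : V →ₗ[ℝ] V) (h : Even (finrank ℝ V)) :
    f.charpoly.coeff 0 = f.det := by
  rw [f.det_eq_sign_charpoly_coeff, h.neg_one_pow, one_mul]

namespace LinearMap.BilinForm

variable {V : Type*} [AddCommGroup V] [Module ℝ V] [FiniteDimensional ℝ V] {B : BilinForm ℝ V}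
  {F : V →ₗ[ℝ] V}

theorem IsLorentzian.det_range_pos (hB : B.IsLorentzian) (hF : ∀ x y, B (F x) y = -B x (F y))
    (h : ∃ w ∈ ker F, B w w < 0) : 0 < (F.rangeRestrict ∘ₗ (range F).subtype).det := by
  obtain ⟨w, hwK, hw⟩ := h
  obtain ⟨n, ⟨b⟩⟩ : ∃ n, Nonempty (Module.Basis (Fin n) ℝ (range F)) :=
    ⟨_, ⟨Module.finBasis ℝ (range F)⟩⟩
  rw [← sign_eq_one_iff, ← sign_det_restrict_range_of_skew hB.nondegenerate hB.symm hF b,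
    sign_eq_one_iff]
  refine det_toMatrix_pos (B := B.restrict (range F)) (fun x y ↦ hB.symm x y) (fun x hx ↦ ?_) b
  refine hB.pos_of_orthogonal w hw x (by simpa using hx) ?_
  obtain ⟨_, y, rfl⟩ := x
  rw [hB.symm]
  exact (mem_ker_iff_of_skew hB.nondegenerate hF).mp hwK y

theorem IsLorentzian.det_range_eq_zero (hB : B.IsLorentzian)
    (hF : ∀ x y, B (F x) y = -B x (F y)) (h : ∃ w ∈ ker F, w ≠ 0 ∧ ∀ u ∈ ker F, B w u = 0) :
    (F.rangeRestrict ∘ₗ (range F).subtype).det = 0 := by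
  obtain ⟨w, hwK, hw, hwu⟩ := h
  let v : range F := ⟨w, mem_range_of_skew hB.nondegenerate hB.symm hF hwu⟩
  by_contra hdet
  have hker := LinearMap.ker_eq_bot.mp
    ((LinearMap.isUnit_iff_ker_eq_bot _).mp ((LinearMap.isUnit_iff_isUnit_det _).mpr
      (isUnit_iff_ne_zero.mpr hdet)))
  have hv : v = 0 := hker (by
    rw [map_zero]
    exact Subtype.ext hwK)
  exact hw (congrArg Subtype.val hv)

theorem IsLorentzian.det_range_neg (hB : B.IsLorentzian) (hF : ∀ x y, B (F x) y = -B x (F y))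
    (h : ∀ w ∈ ker F, w ≠ 0 → 0 < B w w) : (F.rangeRestrict ∘ₗ (range F).subtype).det < 0 := by
  obtain ⟨n, ⟨b⟩⟩ : ∃ n, Nonempty (Module.Basis (Fin n) ℝ (range F)) :=
    ⟨_, ⟨Module.finBasis ℝ (range F)⟩⟩
  rw [← sign_eq_neg_one_iff, ← sign_det_restrict_range_of_skew hB.nondegenerate hB.symm hF b,
    sign_eq_neg_one_iff]
  have hker_range {w : V} (hw : w ∈ ker F) (y : V) : B w (F y) = 0 :=
    (mem_ker_iff_of_skew hB.nondegenerate hF).mp hw y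
  have hdisj : Disjoint (ker F) (range F) := by
    rw [Submodule.disjoint_def]
    rintro _ hw ⟨y, rfl⟩
    by_contra h0
    exact (h _ hw h0).ne' (hker_range hw y)
  have htop : ker F ⊔ range F = ⊤ :=
    Submodule.eq_top_of_disjoint _ _ (by rw [add_comm, F.finrank_range_add_finrank_ker]) hdisj
  obtain ⟨e, he⟩ := hB.exists_neg
  obtain ⟨k, hk, _, ⟨y, rfl⟩, rfl⟩ := Submodule.mem_sup.mp (htop ▸ Submodule.mem_top (x := e))
  have hneg : B (F y) (F y) < 0 := by
    have hkk : 0 ≤ B k k := by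
      by_cases h0 : k = 0
      · simp [h0]
      · exact (h k hk h0).le
    simp only [map_add, LinearMap.add_apply, hB.symm (F y) k, hker_range hk] at he
    linarith
  refine det_toMatrix_neg (B := B.restrict (range F)) (s := F.rangeRestrict y)
    (fun x y ↦ hB.symm x y) hneg (fun x hx hxs ↦ ?_) b
  exact hB.pos_of_orthogonal (F y) hneg x (by simpa using hx) hxs

end LinearMap.BilinForm

/-- The Minkowski form as a bundled bilinear form. -/
noncomputable def minkForm (d : ℕ) : BilinForm ℝ (Fin d → ℝ) :=
  LinearMap.mk₂ ℝ (mink d)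
    (fun x y z ↦ by simp [mink, mul_add, add_mul, Finset.sum_add_distrib])
    (fun c x y ↦ by
      simp only [mink, Pi.smul_apply, smul_eq_mul, Finset.mul_sum]
      exact Finset.sum_congr rfl fun _ _ ↦ by ring)
    (fun x y z ↦ by simp [mink, mul_add, Finset.sum_add_distrib])
    (fun c x y ↦ by
      simp only [mink, Pi.smul_apply, smul_eq_mul, Finset.mul_sum]
      exact Finset.sum_congr rfl fun _ _ ↦ by ring)

theorem mink_succ {n : ℕ} (x y : Fin (n + 1) → ℝ) :
    mink (n + 1) x y = -(x 0 * y 0) + ∑ i : Fin n, x i.succ * y i.succ := by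
  simp [mink, Fin.sum_univ_succ]

theorem isLorentzian_minkForm (n : ℕ) : (minkForm (n + 1)).IsLorentzian where
  symm x y := by
    change mink _ x y = mink _ y x
    simp only [mink_succ, mul_comm]
  exists_neg := ⟨Pi.single 0 1, by
    change mink _ _ _ < 0
    simp [mink_succ]⟩
  pos_of_orthogonal w hw u hu huw := by
    change mink _ w w < 0 at hw
    change mink _ u w = 0 at huw
    change 0 < mink _ u u
    rw [mink_succ] at *
    have hcs := Finset.sum_mul_sq_le_sq_mul_sq Finset.univ (fun i : Fin n ↦ u i.succ)
      (fun i ↦ w i.succ)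
    simp only [← sq] at *
    set U := ∑ i : Fin n, u i.succ ^ 2 with hU
    set W := ∑ i : Fin n, w i.succ ^ 2 with hW
    have hU0 : 0 ≤ U := Finset.sum_nonneg fun i _ ↦ sq_nonneg _
    have heq : ∑ i : Fin n, u i.succ * w i.succ = u 0 * w 0 := by linarith
    rw [heq, mul_pow] at hcs
    by_contra! hle
    have hu0 : u 0 ^ 2 = 0 := by
      by_contra h0
      have hpos : 0 < u 0 ^ 2 := lt_of_le_of_ne (sq_nonneg _) (Ne.symm h0)
      have hW0 : 0 ≤ W := Finset.sum_nonneg fun i _ ↦ sq_nonneg _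
      nlinarith
    have hUz : U = 0 := by linarith
    refine hu (funext (Fin.cases (by simpa using hu0) fun i ↦ ?_))
    simpa using (Finset.sum_eq_zero_iff_of_nonneg fun i _ ↦ sq_nonneg _).mp hUz i
      (Finset.mem_univ i)

/-- With `r := (rank F)/2` and `c_b` the coefficient of `X^{d-2b}` in the
characteristic polynomial of a nonzero skew-symmetric `F`: the sign of `c_r`
determines the causal character of `ker F` (timelike, degenerate, or spacelike
/zero), and all coefficients `c_b` with `r < b ≤ ⌊d/2⌋` vanish. -/
theorem stmt18 (d : ℕ)
    (F : (Fin d → ℝ) →ₗ[ℝ] (Fin d → ℝ)) (hF : IsSkew d F) (hF0 : F ≠ 0) :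
    (0 < (LinearMap.charpoly F).coeff
        (d - 2 * (Module.finrank ℝ (LinearMap.range F) / 2)) ↔
      ∃ w ∈ LinearMap.ker F, mink d w w < 0) ∧
    ((LinearMap.charpoly F).coeff
        (d - 2 * (Module.finrank ℝ (LinearMap.range F) / 2)) = 0 ↔
      ∃ w ∈ LinearMap.ker F, w ≠ 0 ∧ ∀ u ∈ LinearMap.ker F, mink d w u = 0) ∧
    ((LinearMap.charpoly F).coeff
        (d - 2 * (Module.finrank ℝ (LinearMap.range F) / 2)) < 0 ↔
      ∀ w ∈ LinearMap.ker F, w ≠ 0 → 0 < mink d w w) ∧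
    (∀ b : ℕ, Module.finrank ℝ (LinearMap.range F) / 2 < b → b ≤ d / 2 →
      (LinearMap.charpoly F).coeff (d - 2 * b) = 0) := by
  have hd : d ≠ 0 := by
    rintro rfl
    exact hF0 (Subsingleton.elim _ _)
  obtain ⟨n, rfl⟩ := Nat.exists_eq_add_one_of_ne_zero hd
  have hB := isLorentzian_minkForm n
  have hskew : ∀ x y, minkForm (n + 1) (F x) y = -minkForm (n + 1) x (F y) := hF
  obtain ⟨r, hr⟩ := LinearMap.BilinForm.even_finrank_range_of_skew hB.nondegenerate hB.symm hskew
  have hrle : r + r ≤ n + 1 := by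
    simpa [← hr] using (LinearMap.range F).finrank_le
  have hhalf : finrank ℝ (LinearMap.range F) / 2 = r := by omega
  have hcoeff : F.charpoly.coeff (n + 1 - 2 * r) =
      (F.rangeRestrict ∘ₗ (LinearMap.range F).subtype).det := by
    rw [F.charpoly_eq_X_pow_mul_charpoly_range, hr, Module.finrank_fin_fun, ← two_mul,
      Polynomial.coeff_X_pow_mul', if_pos le_rfl, Nat.sub_self,
      LinearMap.charpoly_coeff_zero_of_even_finrank _ ⟨r, hr⟩]
  have hpos := hB.det_range_pos hskew
  have hzero := hB.det_range_eq_zero hskew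
  have hneg := hB.det_range_neg hskew
  have htri := LinearMap.BilinForm.neg_or_degenerate_or_pos hB.symm (LinearMap.ker F)
  simp only [minkForm, LinearMap.mk₂_apply] at hpos hzero hneg htri
  simp only [hhalf]
  rw [hcoeff]
  refine ⟨⟨fun h ↦ ?_, hpos⟩, ⟨fun h ↦ ?_, hzero⟩, ⟨fun h ↦ ?_, hneg⟩, fun b hb hbd ↦ ?_⟩
  · rcases htri with h' | h' | h'
    · exact h'
    · exact absurd (hzero h') h.ne'
    · exact absurd (hneg h') h.not_gt
  · rcases htri with h' | h' | h'
    · exact absurd h (hpos h').ne'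
    · exact h'
    · exact absurd h (hneg h').ne
  · rcases htri with h' | h' | h'
    · exact absurd (hpos h') h.not_gt
    · exact absurd (hzero h') h.ne
    · exact h'
  · rw [F.charpoly_eq_X_pow_mul_charpoly_range, hr, Module.finrank_fin_fun,
      Polynomial.coeff_X_pow_mul', if_neg (by omega)]
end

section
/- Let n ≥ 2, fix ν ∈ ℝ, vectors a, b ∈ ℝⁿ and a real n × n matrix ω with ωᵀ = -ω, and define the smooth vector field ξ : ℝⁿ → ℝⁿ by ξ(y)ᴬ = bᴬ + ν·yᴬ + (∑_B a_B y^B)·yᴬ - (1/2)·(∑_B y_B y^B)·aᴬ - ∑_B ωᴬ_B y^B. Define η : ℝⁿ → ℝⁿ by η(y)^{n-2} = -y^{n-1}, η(y)^{n-1} = y^{n-2}, and η(y)ᴬ = 0 for A < n-2 (indices 0, …, n-1). If the Euclidean dot product satisfies ⟨ξ(y), η(y)⟩ = 0 for all y ∈ ℝⁿ, then the Lie bracket [ξ, η], defined by [ξ, η](y) = (fderiv of η at y applied to ξ(y)) - (fderiv of ξ at y applied to η(y)), vanishes identically on ℝⁿ. -/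
open scoped BigOperators

/-- The vector field `b + ν y + ⟨a, y⟩ y - ½ |y|² a - ω y` on `ℝⁿ`, in coordinates. -/
noncomputable def conformalField {ι : Type*} [Fintype ι] (ν : ℝ) (a b : ι → ℝ) (ω : Matrix ι ι ℝ)
    (y : ι → ℝ) (A : ι) : ℝ :=
  b A + ν * y A + (∑ B, a B * y B) * y A - (1 / 2) * (∑ B, y B * y B) * a A - ∑ B, ω A B * y B

/-- If the `q`-component of a conformal field vanishes wherever `y q = 0` and `y p ≠ 0`, then
all coefficients contributing to it, apart from `ν`, `a` along `y` and `ω q q`, vanish. -/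
lemma conformalField_coeff_eq_zero {ι : Type*} [Fintype ι] [DecidableEq ι] {ν : ℝ} {a b : ι → ℝ}
    {ω : Matrix ι ι ℝ} {p q : ι} (hpq : p ≠ q)
    (h : ∀ y : ι → ℝ, y q = 0 → y p ≠ 0 → conformalField ν a b ω y q = 0) :
    b q = 0 ∧ a q = 0 ∧ ∀ B, B ≠ q → ω q B = 0 := by
  have line (s : ℝ) (hs : s ≠ 0) : b q - 1 / 2 * (s * s) * a q - ω q p * s = 0 := by
    have := h (Pi.single p s) (by simp [hpq.symm]) (by simpa using hs)
    simpa [conformalField, Pi.single_apply, hpq.symm] using this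
  have h1 := line 1 (by norm_num)
  have h2 := line (-1) (by norm_num)
  have h3 := line 2 (by norm_num)
  have hb : b q = 0 := by linarith
  have ha : a q = 0 := by linarith
  have hp : ω q p = 0 := by linarith
  refine ⟨hb, ha, fun B hB => ?_⟩
  by_cases hBp : B = p
  · rw [hBp, hp]
  have := h (Pi.single p 1 + Pi.single B 1) (by simp [hpq.symm, Ne.symm hB])
    (by simp [Ne.symm hBp])
  simpa [conformalField, hb, ha, hp, mul_add, Finset.sum_add_distrib, Pi.single_apply, hpq.symm,
    Ne.symm hB] using this

/-- The directional derivative of a conformal field, component by component. -/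
lemma fderiv_conformalField_apply {ι : Type*} [Fintype ι] (ν : ℝ) (a b : ι → ℝ)
    (ω : Matrix ι ι ℝ) (y v : ι → ℝ) (A : ι) :
    fderiv ℝ (conformalField ν a b ω) y v A =
      ν * v A + (∑ B, a B * v B) * y A + (∑ B, a B * y B) * v A
        - (∑ B, y B * v B) * a A - ∑ B, ω A B * v B := by
  have hd : DifferentiableAt ℝ (conformalField ν a b ω) y := by
    unfold conformalField
    fun_prop
  have hproj (B : ι) : HasDerivAt (fun t : ℝ => (y + t • v) B) (v B) 0 := by
    simpa using ((hasDerivAt_id (0 : ℝ)).mul_const (v B)).const_add (y B)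
  have hsum (c : ι → ℝ) :
      HasDerivAt (fun t : ℝ => ∑ B, c B * (y + t • v) B) (∑ B, c B * v B) 0 :=
    HasDerivAt.fun_sum fun B _ => (hproj B).const_mul (c B)
  have hsq : HasDerivAt (fun t : ℝ => ∑ B, (y + t • v) B * (y + t • v) B)
      (2 * ∑ B, y B * v B) 0 := by
    rw [Finset.mul_sum]
    refine HasDerivAt.fun_sum fun B _ => ?_
    refine ((hproj B).fun_mul (hproj B)).congr_deriv ?_
    rw [zero_smul, add_zero]
    ring
  have hcoord : HasDerivAt (fun t : ℝ => conformalField ν a b ω (y + t • v) A)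
      (fderiv ℝ (conformalField ν a b ω) y v A) 0 :=
    hasDerivAt_pi.1 (hd.hasFDerivAt.hasLineDerivAt v) A
  refine (hcoord.unique (((((hproj A).const_mul ν).const_add (b A)).fun_add
    ((hsum a).fun_mul (hproj A))).fun_sub ((hsq.const_mul (1 / 2)).mul_const (a A)) |>.fun_sub
      (hsum (ω A)))).trans ?_
  rw [zero_smul, add_zero]
  ring

/-- If a general conformal Killing vector field `ξ` of Euclidean `ℝⁿ` is
pointwise orthogonal to the axial vector field
`η = y^{n-2} ∂_{n-1} - y^{n-1} ∂_{n-2}`, then the Lie bracket `[ξ, η]`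
vanishes identically. -/
theorem stmt19 (n : ℕ) (hn : 2 ≤ n) (ν : ℝ) (a b : Fin n → ℝ)
    (ω : Matrix (Fin n) (Fin n) ℝ) (hω : ω.transpose = -ω)
    (ξ η : (Fin n → ℝ) → (Fin n → ℝ))
    (hξ : ∀ (y : Fin n → ℝ) (A : Fin n),
      ξ y A = b A + ν * y A + (∑ B, a B * y B) * y A
        - (1 / 2) * (∑ B, y B * y B) * a A - ∑ B, ω A B * y B)
    (hη1 : ∀ y : Fin n → ℝ, η y ⟨n - 2, by omega⟩ = -(y ⟨n - 1, by omega⟩))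
    (hη2 : ∀ y : Fin n → ℝ, η y ⟨n - 1, by omega⟩ = y ⟨n - 2, by omega⟩)
    (hη3 : ∀ (y : Fin n → ℝ) (A : Fin n), (A : ℕ) < n - 2 → η y A = 0)
    (horth : ∀ y : Fin n → ℝ, ∑ A, ξ y A * η y A = 0) :
    ∀ y : Fin n → ℝ, fderiv ℝ η y (ξ y) - fderiv ℝ ξ y (η y) = 0 := by
  obtain rfl : ξ = conformalField ν a b ω := by
    funext y A
    exact hξ y A
  set p : Fin n := ⟨n - 2, by omega⟩ with hp
  set q : Fin n := ⟨n - 1, by omega⟩ with hq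
  have hpq : p ≠ q := by simp only [hp, hq, ne_eq, Fin.mk.injEq]; omega
  have hη0 (y : Fin n → ℝ) (A : Fin n) (hAp : A ≠ p) (hAq : A ≠ q) : η y A = 0 := by
    refine hη3 y A ?_
    have := A.isLt
    simp only [hp, hq, ne_eq, Fin.ext_iff] at hAp hAq
    omega
  have hsum (y c : Fin n → ℝ) : ∑ A, c A * η y A = c q * y p - c p * y q := by
    rw [Fintype.sum_eq_add p q hpq fun A hA => by rw [hη0 y A hA.1 hA.2, mul_zero], hη1, hη2]
    ring
  have hrel (y : Fin n → ℝ) :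
      conformalField ν a b ω y q * y p - conformalField ν a b ω y p * y q = 0 := by
    rw [← hsum, horth]
  obtain ⟨hbq, haq, hωq⟩ := conformalField_coeff_eq_zero (ν := ν) (a := a) (b := b) (ω := ω) hpq
    fun y h0 h1 => by simpa [h0, h1] using hrel y
  obtain ⟨hbp, hap, hωp⟩ := conformalField_coeff_eq_zero (ν := ν) (a := a) (b := b) (ω := ω)
    hpq.symm fun y h0 h1 => by simpa [h0, h1] using hrel y
  have hanti (A B : Fin n) : ω A B = -ω B A := congrFun (congrFun hω B) A
  have hdiag (A : Fin n) : ω A A = 0 := by linarith [hanti A A]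
  have hωq' (B : Fin n) : ω q B = 0 := by
    by_cases h : B = q
    · rw [h, hdiag]
    · exact hωq B h
  have hωp' (B : Fin n) : ω p B = 0 := by
    by_cases h : B = p
    · rw [h, hdiag]
    · exact hωp B h
  let L : (Fin n → ℝ) →ₗ[ℝ] (Fin n → ℝ) :=
    { toFun := η
      map_add' := fun x y => by
        funext A
        by_cases hAp : A = p
        · simp only [hAp, Pi.add_apply, hη1]; ring
        by_cases hAq : A = q
        · simp only [hAq, Pi.add_apply, hη2]
        simp [hη0 _ A hAp hAq]
      map_smul' := fun c x => by
        funext A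
        by_cases hAp : A = p
        · simp [hAp, hη1]
        by_cases hAq : A = q
        · simp [hAq, hη2]
        simp [hη0 _ A hAp hAq] }
  have hfη (y v : Fin n → ℝ) : fderiv ℝ η y v = η v :=
    congrArg (· v) (LinearMap.toContinuousLinearMap L).fderiv
  intro y
  have hξη (A : Fin n) : fderiv ℝ (conformalField ν a b ω) y (η y) A =
      (ν + ∑ B, a B * y B) * η y A := by
    rw [fderiv_conformalField_apply, hsum, hsum, hsum, haq, hap, hanti A q, hanti A p, hωq', hωp']
    ring
  have hξp : conformalField ν a b ω y p = (ν + ∑ B, a B * y B) * y p := by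
    simp only [conformalField, hbp, hap, hωp', zero_mul, Finset.sum_const_zero]
    ring
  have hξq : conformalField ν a b ω y q = (ν + ∑ B, a B * y B) * y q := by
    simp only [conformalField, hbq, haq, hωq', zero_mul, Finset.sum_const_zero]
    ring
  funext A
  rw [Pi.sub_apply, hξη, hfη, Pi.zero_apply]
  by_cases hAp : A = p
  · rw [hAp, hη1, hη1, hξq]; ring
  by_cases hAq : A = q
  · rw [hAq, hη2, hη2, hξp]; ring
  rw [hη0 _ A hAp hAq, hη0 _ A hAp hAq, mul_zero, sub_zero]
end
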